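/- arXiv:1705.09979 — 3 statements merged into one kernel-verified Lean document; each statement's English description precedes it below -/
import Mathlib

section
/- Let k ≥ 2 and let G be a finite simple graph on n vertices such that ē_G(X) ≥ (k-1)|X| + 1 for every subset X ⊆ V(G) with 1 ≤ |X| ≤ n-k+1. Then every good set D in G with |D| ≤ n-k+1 satisfies ē_G(D) ≤ (k-1)|D| + 1. -/
/-- The number of edges of `G` incident with at least one vertex of `X`. -/
def eBar {V : Type*} [Fintype V] [DecidableEq V] (G : SimpleGraph V) [DecidableRel G.Adj]
    (X : Finset V) : ℕ :=
  (G.edgeFinset.filter (fun e => ∃ v ∈ X, v ∈ e)).card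

/-- Good sets in `G` (Definition 2.1): `{v}` is good for any vertex `v` of degree exactly
`k`; a good set may be extended by a vertex of degree at most `k-1` in the complement graph;
the union of two intersecting good sets is good; and the union of two good sets joined by an
edge is good. -/
inductive IsGoodSet {V : Type*} [Fintype V] [DecidableEq V] (k : ℕ) (G : SimpleGraph V)
    [DecidableRel G.Adj] : Finset V → Prop
  | single (v : V) (hv : G.degree v = k) : IsGoodSet k G {v}
  | extend (A : Finset V) (v : V) (hA : IsGoodSet k G A) (hv : v ∉ A)
      (hdeg : (G.neighborFinset v \ A).card ≤ k - 1) : IsGoodSet k G (insert v A)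
  | inter (A B : Finset V) (hA : IsGoodSet k G A) (hB : IsGoodSet k G B)
      (hAB : (A ∩ B).Nonempty) : IsGoodSet k G (A ∪ B)
  | join (A B : Finset V) (hA : IsGoodSet k G A) (hB : IsGoodSet k G B)
      (hedge : ∃ a ∈ A, ∃ b ∈ B, G.Adj a b) : IsGoodSet k G (A ∪ B)

theorem eBar_empty_aux {V : Type*} [Fintype V] [DecidableEq V] (G : SimpleGraph V)
    [DecidableRel G.Adj] (A : Finset V) (v : V) :
    eBar G (insert v A) ≤ eBar G A + (G.neighborFinset v \ A).card := by
  unfold eBar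
  have h : (G.edgeFinset.filter (fun e => ∃ u ∈ insert v A, u ∈ e)) ⊆
      (G.edgeFinset.filter (fun e => ∃ u ∈ A, u ∈ e)) ∪
        (G.neighborFinset v \ A).image (fun w => s(v, w)) := by
    intro e he
    simp only [Finset.mem_filter, Finset.mem_union, Finset.mem_image, Finset.mem_sdiff,
      SimpleGraph.mem_neighborFinset, Finset.mem_insert] at he ⊢
    obtain ⟨he, u, hu, hue⟩ := he
    by_cases hA : ∃ u ∈ A, u ∈ e
    · exact Or.inl ⟨he, hA⟩
    · right
      rcases hu with rfl | hu
      · obtain ⟨w, rfl⟩ := hue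
        refine ⟨w, ⟨by simpa using he, fun hw => hA ⟨w, hw, by simp⟩⟩, rfl⟩
      · exact absurd ⟨u, hu, hue⟩ hA
  refine (Finset.card_le_card h).trans ((Finset.card_union_le _ _).trans ?_)
  exact Nat.add_le_add_left Finset.card_image_le _

theorem eBar_union_aux {V : Type*} [Fintype V] [DecidableEq V] (G : SimpleGraph V)
    [DecidableRel G.Adj] (A B : Finset V) :
    eBar G (A ∪ B) + ((G.edgeFinset.filter (fun e => ∃ u ∈ A, u ∈ e)) ∩
      (G.edgeFinset.filter (fun e => ∃ u ∈ B, u ∈ e))).card = eBar G A + eBar G B := by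
  unfold eBar
  rw [← Finset.card_union_add_card_inter (G.edgeFinset.filter (fun e => ∃ u ∈ A, u ∈ e))
    (G.edgeFinset.filter (fun e => ∃ u ∈ B, u ∈ e))]
  congr 2
  ext e
  simp only [Finset.mem_filter, Finset.mem_union]
  grind

/-- If every non-empty `X ⊆ V(G)` with `|X| ≤ n-k+1` satisfies `ē_G(X) ≥ (k-1)|X| + 1`,
then every good set `D` with `|D| ≤ n-k+1` satisfies `ē_G(D) ≤ (k-1)|D| + 1`. -/
theorem eBar_goodSet_le {V : Type*} [Fintype V] [DecidableEq V]
    (k n : ℕ) (hk : 2 ≤ k) (G : SimpleGraph V) [DecidableRel G.Adj]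
    (hn : Fintype.card V = n)
    (hX : ∀ X : Finset V, X.Nonempty → X.card + k ≤ n + 1 →
        (k - 1) * X.card + 1 ≤ eBar G X) :
    ∀ D : Finset V, IsGoodSet k G D → D.card + k ≤ n + 1 →
      eBar G D ≤ (k - 1) * D.card + 1 := by
  have key : ∀ A B : Finset V, (A ∩ B).Nonempty →
      (A.card + k ≤ n + 1 → eBar G A ≤ (k - 1) * A.card + 1) →
      (B.card + k ≤ n + 1 → eBar G B ≤ (k - 1) * B.card + 1) →
      (A ∪ B).card + k ≤ n + 1 → eBar G (A ∪ B) ≤ (k - 1) * (A ∪ B).card + 1 := by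
    intro A B hAB hA hB hc
    have h1 := Finset.card_le_card (Finset.subset_union_left (s₁ := A) (s₂ := B))
    have h2 := Finset.card_le_card (Finset.subset_union_right (s₁ := A) (s₂ := B))
    have h3 := Finset.card_le_card (Finset.inter_subset_left (s₁ := A) (s₂ := B))
    have hA := hA (by omega)
    have hB := hB (by omega)
    have hI := hX _ hAB (by omega)
    have hu := eBar_union_aux G A B
    have hs : eBar G (A ∩ B) ≤ ((G.edgeFinset.filter (fun e => ∃ u ∈ A, u ∈ e)) ∩
      (G.edgeFinset.filter (fun e => ∃ u ∈ B, u ∈ e))).card := by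
      apply Finset.card_le_card
      intro e he
      simp only [Finset.mem_filter, Finset.mem_inter] at he ⊢
      grind
    have hc := congrArg (fun x => (k - 1) * x) (Finset.card_union_add_card_inter A B)
    simp only [mul_add] at hc
    omega
  intro D hD
  induction hD with
  | single v hv =>
    intro _
    have h := eBar_empty_aux G ∅ v
    have h0 : eBar G ∅ = 0 := by simp [eBar]
    simp [h0, hv] at h
    simp
    omega
  | extend A v hA hv hdeg ih =>
    intro hc
    rw [Finset.card_insert_of_notMem hv] at hc ⊢
    have h := eBar_empty_aux G A v
    have := ih (by omega)
    rw [mul_add]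
    omega
  | inter A B _ _ hAB ihA ihB => exact key A B hAB ihA ihB
  | join A B _ _ hedge ihA ihB =>
    by_cases hAB : (A ∩ B).Nonempty
    · exact key A B hAB ihA ihB
    · intro hc
      rw [Finset.not_nonempty_iff_eq_empty] at hAB
      have hcard := Finset.card_union_add_card_inter A B
      rw [hAB, Finset.card_empty, add_zero] at hcard
      have hA := ihA (by omega)
      have hB := ihB (by omega)
      have hu := eBar_union_aux G A B
      obtain ⟨a, ha, b, hb, hab⟩ := hedge
      have hp : 0 < ((G.edgeFinset.filter (fun e => ∃ u ∈ A, u ∈ e)) ∩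
          (G.edgeFinset.filter (fun e => ∃ u ∈ B, u ∈ e))).card := by
        apply Finset.card_pos.mpr
        refine ⟨s(a, b), ?_⟩
        simp only [Finset.mem_filter, Finset.mem_inter, SimpleGraph.mem_edgeFinset,
          SimpleGraph.mem_edgeSet]
        exact ⟨⟨hab, a, ha, by simp⟩, ⟨hab, b, hb, by simp⟩⟩
      rw [hcard, mul_add]
      omega
end

section
/- Let k ≥ 2 and let t be an integer with 1 ≤ t ≤ (k-2)(k+1)/2 - 1. Let G be a finite simple graph on n ≥ k+1 vertices with e(G) ≥ (k-1)n - t, such that ē_G(X) ≥ (k-1)|X| + 1 for every subset X ⊆ V(G) with 1 ≤ |X| ≤ n-k+1. If G contains a good set D with |D| > n/k, then G contains a non-empty subgraph on at most (1 - 1/(2k))·n vertices with minimum degree at least k. -/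
section helpers
variable {V : Type*} [Fintype V] [DecidableEq V] (G : SimpleGraph V) [DecidableRel G.Adj]

/-- Edges incident with `X`. -/
def incEdges (X : Finset V) : Finset (Sym2 V) :=
  G.edgeFinset.filter (fun e => ∃ v ∈ X, v ∈ e)

lemma eBar_eq (X : Finset V) : eBar G X = (incEdges G X).card := rfl

lemma incEdges_union (A B : Finset V) :
    incEdges G (A ∪ B) = incEdges G A ∪ incEdges G B := by
  ext e
  simp only [incEdges, Finset.mem_filter, Finset.mem_union]
  grind

lemma incEdges_inter (A B : Finset V) :
    incEdges G (A ∩ B) ⊆ incEdges G A ∩ incEdges G B := by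
  intro e
  simp only [incEdges, Finset.mem_filter, Finset.mem_inter]
  grind

lemma eBar_submod (A B : Finset V) :
    eBar G (A ∪ B) + eBar G (A ∩ B) ≤ eBar G A + eBar G B := by
  simp only [eBar_eq]
  rw [incEdges_union, ← Finset.card_union_add_card_inter (incEdges G A)]
  have := Finset.card_le_card (incEdges_inter G A B)
  omega

lemma eBar_join (A B : Finset V) (h : ∃ a ∈ A, ∃ b ∈ B, G.Adj a b) :
    eBar G (A ∪ B) + 1 ≤ eBar G A + eBar G B := by
  simp only [eBar_eq]
  rw [incEdges_union, ← Finset.card_union_add_card_inter (incEdges G A)]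
  have : 0 < (incEdges G A ∩ incEdges G B).card := by
    obtain ⟨a, ha, b, hb, hab⟩ := h
    refine Finset.card_pos.mpr ⟨s(a, b), ?_⟩
    simp only [incEdges, Finset.mem_filter, Finset.mem_inter, SimpleGraph.mem_edgeFinset,
      SimpleGraph.mem_edgeSet]
    exact ⟨⟨hab, a, ha, by simp⟩, ⟨hab, b, hb, by simp⟩⟩
  omega

lemma eBar_insert (A : Finset V) (v : V) :
    eBar G (insert v A) ≤ eBar G A + (G.neighborFinset v \ A).card := by
  simp only [eBar_eq]
  have hsub : incEdges G (insert v A) ⊆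
      incEdges G A ∪ (G.neighborFinset v \ A).image (fun u => s(v, u)) := by
    intro e
    simp only [incEdges, Finset.mem_filter, Finset.mem_union, Finset.mem_image,
      Finset.mem_sdiff, SimpleGraph.mem_edgeFinset, SimpleGraph.mem_neighborFinset]
    rintro ⟨he, w, hw, hwe⟩
    by_cases h : ∃ w ∈ A, w ∈ e
    · exact Or.inl ⟨he, h⟩
    · right
      have hwv : w = v := by grind
      subst hwv
      obtain ⟨u, rfl⟩ := Sym2.mem_iff_exists.mp hwe
      exact ⟨u, ⟨he, fun hu => h ⟨u, hu, by simp⟩⟩, rfl⟩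
  have h1 := Finset.card_le_card hsub
  have h2 := Finset.card_union_le (incEdges G A)
    ((G.neighborFinset v \ A).image (fun u => s(v, u)))
  have h3 := Finset.card_image_le (s := G.neighborFinset v \ A) (f := fun u => s(v, u))
  omega

lemma edges_le (A : Finset V) :
    G.edgeFinset.card ≤ eBar G A + (Aᶜ.card).choose 2 := by
  have h := Finset.card_filter_add_card_filter_not (s := G.edgeFinset)
    (fun e => ∃ v ∈ A, v ∈ e)
  have hsub : G.edgeFinset.filter (fun e => ¬ ∃ v ∈ A, v ∈ e) ⊆
      (Aᶜ).offDiag.image Sym2.mk.uncurry := by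
    intro e
    induction e with
    | _ x y =>
      simp only [Finset.mem_filter, SimpleGraph.mem_edgeFinset, SimpleGraph.mem_edgeSet,
        Finset.mem_image]
      rintro ⟨hxy, hn⟩
      refine ⟨(x, y), ?_, rfl⟩
      simp only [Finset.mem_offDiag, Finset.mem_compl]
      exact ⟨fun hx => hn ⟨x, hx, by simp⟩, fun hy => hn ⟨y, hy, by simp⟩, hxy.ne⟩
  have h1 := Finset.card_le_card hsub
  have h2 := Sym2.card_image_offDiag (Aᶜ)
  have h3 : eBar G A = (G.edgeFinset.filter (fun e => ∃ v ∈ A, v ∈ e)).card := rfl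
  omega

variable {G}

lemma good_eBar {k n : ℕ} (hk : 2 ≤ k)
    (hX : ∀ X : Finset V, X.Nonempty → X.card + k ≤ n + 1 →
        (k - 1) * X.card + 1 ≤ eBar G X)
    (D : Finset V) (hD : IsGoodSet k G D) (hc : D.card + k ≤ n + 1) :
    eBar G D ≤ (k - 1) * D.card + 1 := by
  have hinter : ∀ A B : Finset V,
      (A.card + k ≤ n + 1 → eBar G A ≤ (k - 1) * A.card + 1) →
      (B.card + k ≤ n + 1 → eBar G B ≤ (k - 1) * B.card + 1) →
      (A ∩ B).Nonempty → (A ∪ B).card + k ≤ n + 1 →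
      eBar G (A ∪ B) ≤ (k - 1) * (A ∪ B).card + 1 := by
    intro A B ihA ihB hAB hc
    have h1 := Finset.card_le_card (Finset.subset_union_left (s₁ := A) (s₂ := B))
    have h2 := Finset.card_le_card (Finset.subset_union_right (s₁ := A) (s₂ := B))
    have h3 := Finset.card_le_card (Finset.inter_subset_left (s₁ := A) (s₂ := B))
    have h4 := ihA (by omega)
    have h5 := ihB (by omega)
    have h6 := hX _ hAB (by omega)
    have h7 := eBar_submod G A B
    have h8 := congrArg (fun x => (k - 1) * x) (Finset.card_union_add_card_inter A B)
    simp only [mul_add] at h8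
    omega
  induction hD with
  | single v hv =>
    have h := eBar_insert G ∅ v
    have h0 : eBar G ∅ = 0 := by simp [eBar]
    simp only [Finset.sdiff_empty, SimpleGraph.card_neighborFinset_eq_degree, hv, h0] at h
    simp only [Finset.card_singleton]
    have h2 : eBar G {v} ≤ 0 + k := h
    omega
  | extend A v hA hv hdeg ih =>
    rw [Finset.card_insert_of_notMem hv] at hc ⊢
    have h := eBar_insert G A v
    have := ih (by omega)
    rw [mul_add]
    omega
  | inter A B hA hB hAB ihA ihB => exact hinter A B ihA ihB hAB hc
  | join A B hA hB hedge ihA ihB =>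
    by_cases hAB : (A ∩ B).Nonempty
    · exact hinter A B ihA ihB hAB hc
    · have h0 : (A ∩ B).card = 0 := by
        rw [Finset.not_nonempty_iff_eq_empty.mp hAB]; rfl
      have h8 := Finset.card_union_add_card_inter A B
      have h4 := ihA (by omega)
      have h5 := ihB (by omega)
      have h7 := eBar_join G A B hedge
      have h9 : (A ∪ B).card = A.card + B.card := by omega
      rw [h9, mul_add]
      omega

lemma good_medium {k n : ℕ} (hk : 2 ≤ k) (hnk : k + 1 ≤ n)
    (D : Finset V) (hD : IsGoodSet k G D) (hc : n ≤ 2 * k * D.card) :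
    ∃ M : Finset V, IsGoodSet k G M ∧ n ≤ 2 * k * M.card ∧ M.card + k ≤ n + 1 := by
  have hun : ∀ A B : Finset V, IsGoodSet k G (A ∪ B) →
      (n ≤ 2 * k * A.card →
        ∃ M : Finset V, IsGoodSet k G M ∧ n ≤ 2 * k * M.card ∧ M.card + k ≤ n + 1) →
      (n ≤ 2 * k * B.card →
        ∃ M : Finset V, IsGoodSet k G M ∧ n ≤ 2 * k * M.card ∧ M.card + k ≤ n + 1) →
      n ≤ 2 * k * (A ∪ B).card →
      ∃ M : Finset V, IsGoodSet k G M ∧ n ≤ 2 * k * M.card ∧ M.card + k ≤ n + 1 := by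
    intro A B hg ihA ihB hc
    by_cases hA : n ≤ 2 * k * A.card
    · exact ihA hA
    by_cases hB : n ≤ 2 * k * B.card
    · exact ihB hB
    refine ⟨_, hg, hc, ?_⟩
    have h := Finset.card_union_le A B
    by_contra hcon
    have h1 : k * (A ∪ B).card ≤ k * (A.card + B.card) := Nat.mul_le_mul_left _ h
    have h2 : k * (A ∪ B).card < n := by nlinarith
    push Not at hcon
    generalize (A ∪ B).card = m at *
    obtain ⟨d, rfl⟩ := Nat.exists_eq_add_of_le hnk
    have h3 : d + 3 ≤ m := by omega
    have h4 : k * (d + 3) ≤ k * m := Nat.mul_le_mul_left _ h3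
    nlinarith
  induction hD with
  | single v hv => exact ⟨_, .single v hv, hc, by simp; omega⟩
  | extend A v hA hv hdeg ih =>
    by_cases hA' : n ≤ 2 * k * A.card
    · exact ih hA'
    refine ⟨_, .extend A v hA hv hdeg, hc, ?_⟩
    rw [Finset.card_insert_of_notMem hv]
    by_contra hcon
    push Not at hcon hA'
    generalize A.card = m at *
    obtain ⟨d, rfl⟩ := Nat.exists_eq_add_of_le hnk
    have h3 : d + 2 ≤ m := by omega
    have h4 : k * (d + 2) ≤ k * m := Nat.mul_le_mul_left _ h3
    nlinarith
  | inter A B hA hB hAB ihA ihB => exact hun A B (.inter A B hA hB hAB) ihA ihB hc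
  | join A B hA hB hedge ihA ihB => exact hun A B (.join A B hA hB hedge) ihA ihB hc

end helpers

/-- Let `1 ≤ t ≤ (k-2)(k+1)/2 - 1` and let `G` have `n ≥ k+1` vertices and at least
`(k-1)n - t` edges, such that `ē_G(X) ≥ (k-1)|X| + 1` for all non-empty `X` with
`|X| ≤ n-k+1`. If `G` contains a good set `D` with `|D| > n/k`, then `G` contains a
non-empty subgraph on at most `(1 - 1/(2k))·n` vertices with minimum degree at least `k`. -/
theorem big_goodSet_gives_small_subgraph {V : Type*} [Fintype V] [DecidableEq V]
    (k t n : ℕ) (hk : 2 ≤ k) (ht1 : 1 ≤ t) (ht2 : t ≤ (k - 2) * (k + 1) / 2 - 1)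
    (G : SimpleGraph V) [DecidableRel G.Adj]
    (hn : Fintype.card V = n) (hnk : k + 1 ≤ n)
    (he : (k - 1) * n ≤ G.edgeFinset.card + t)
    (hX : ∀ X : Finset V, X.Nonempty → X.card + k ≤ n + 1 →
        (k - 1) * X.card + 1 ≤ eBar G X)
    (D : Finset V) (hD : IsGoodSet k G D) (hDbig : (n : ℝ) / (k : ℝ) < (D.card : ℝ)) :
    ∃ s : Finset V, s.Nonempty ∧
      (s.card : ℝ) ≤ (1 - 1 / (2 * (k : ℝ))) * (n : ℝ) ∧
      ∀ v ∈ s, k ≤ (s.filter (fun u => G.Adj v u)).card := by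
  classical
  have hc : n ≤ 2 * k * D.card := by
    have hk0 : (0 : ℝ) < k := by exact_mod_cast (by omega : 0 < k)
    rw [div_lt_iff₀ hk0] at hDbig
    have : n < D.card * k := by exact_mod_cast hDbig
    nlinarith
  obtain ⟨M₀, hM₀⟩ := good_medium hk hnk D hD hc
  let F : Finset (Finset V) := Finset.univ.filter
    (fun M => IsGoodSet k G M ∧ n ≤ 2 * k * M.card ∧ M.card + k ≤ n + 1)
  have hF : F.Nonempty := ⟨M₀, by simpa [F] using hM₀⟩
  obtain ⟨M, hMF, hmax⟩ := F.exists_max_image Finset.card hF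
  obtain ⟨hMg, hMl, hMu⟩ : IsGoodSet k G M ∧ n ≤ 2 * k * M.card ∧ M.card + k ≤ n + 1 := by
    simpa [F] using hMF
  have hcompl : (Mᶜ).card + M.card = n := by rw [← hn]; exact Finset.card_compl_add_card M
  have hMk : M.card + k ≤ n := by
    by_contra hcon
    have hMe : M.card + k = n + 1 := by omega
    have h1 := good_eBar hk hX M hMg hMu
    have h2 := edges_le G M
    have h3 : (Mᶜ).card = k - 1 := by omega
    rw [h3, Nat.choose_two_right] at h2
    obtain ⟨j, rfl⟩ := Nat.exists_eq_add_of_le hk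
    have e1 : 2 + j - 1 = j + 1 := by omega
    have e2 : 2 + j - 2 = j := by omega
    have e3 : j + 1 - 1 = j := by omega
    have e4 : n = M.card + (j + 1) := by omega
    rw [e1, e3] at h2
    rw [e1] at h1 he
    rw [e2] at ht2
    rw [e4, mul_add] at he
    have h5 := Nat.div_mul_le_self ((j + 1) * j) 2
    have h6 := Nat.div_mul_le_self (j * (2 + j + 1)) 2
    have h7 : 2 * (t + 1) ≤ j * (2 + j + 1) := by omega
    nlinarith
  refine ⟨Mᶜ, Finset.card_pos.mp (by omega), ?_, ?_⟩
  · have hk0 : (0 : ℝ) < k := by exact_mod_cast (by omega : 0 < k)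
    have h1 : ((Mᶜ).card : ℝ) + M.card = n := by exact_mod_cast hcompl
    have h2 : (n : ℝ) ≤ 2 * k * M.card := by exact_mod_cast hMl
    have h3 : (n : ℝ) / (2 * k) ≤ M.card := by
      rw [div_le_iff₀ (by positivity)]; linarith
    have h4 : (1 - 1 / (2 * (k : ℝ))) * (n : ℝ) = n - n / (2 * k) := by ring
    rw [h4]; linarith
  · intro v hv
    have hvM : v ∉ M := by simpa using hv
    by_contra hcon
    have heq : Mᶜ.filter (fun u => G.Adj v u) = G.neighborFinset v \ M := by
      ext u; simp [and_comm]
    rw [heq] at hcon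
    have hci := Finset.card_insert_of_notMem hvM
    have hmem : insert v M ∈ F := by
      simp only [F, Finset.mem_filter, Finset.mem_univ, true_and]
      refine ⟨.extend M v hMg hvM (by omega), ?_, by omega⟩
      rw [hci]; nlinarith
    have := hmax _ hmem
    omega
end

section
/- Let k ≥ 2, let t be an integer with 1 ≤ t ≤ (k-2)(k+1)/2 - 1, and let ε = 1/max(10^4·k^2, 100·k·t). Let G be a finite simple graph on n ≥ k-1 vertices with e(G) ≥ (k-1)n - t, and suppose there exists a subset X ⊆ V(G) with 1 ≤ |X| ≤ n-k+1 and ē_G(X) ≤ (k-1)|X|. Then the graph G - X contains a non-empty subgraph on at most (1-ε)·(n-|X|) vertices with minimum degree at least k. -/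
set_option linter.unusedSectionVars false
set_option linter.unusedSimpArgs false
namespace MinDeg

variable {V : Type*} [Fintype V] [DecidableEq V] (G : SimpleGraph V) [DecidableRel G.Adj]

/-- number of neighbours of `v` in `A` -/
def dg (A : Finset V) (v : V) : ℕ := (A.filter (fun u => G.Adj v u)).card

/-- number of ordered adjacent pairs from `A` to `B` -/
def cr (A B : Finset V) : ℕ := ∑ a ∈ A, dg G B a

/-- twice the deficiency `(k-1)|A| - e(A)` -/
def ph (k : ℕ) (A : Finset V) : ℤ := 2 * ((k : ℤ) - 1) * A.card - cr G A A

/-- minimum degree at least `k` inside `A` -/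
def Cl (k : ℕ) (A : Finset V) : Prop := ∀ v ∈ A, k ≤ dg G A v

lemma dg_eq_sum (A : Finset V) (v : V) : dg G A v = ∑ u ∈ A, if G.Adj v u then 1 else 0 := by
  simp [dg, Finset.sum_ite]

lemma dg_mono {A B : Finset V} (h : A ⊆ B) (v : V) : dg G A v ≤ dg G B v :=
  Finset.card_le_card (Finset.filter_subset_filter _ h)

lemma dg_union {A B : Finset V} (h : Disjoint A B) (v : V) :
    dg G (A ∪ B) v = dg G A v + dg G B v := by
  simp [dg_eq_sum, Finset.sum_union h]

lemma dg_sdiff {A B : Finset V} (h : B ⊆ A) (v : V) :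
    dg G (A \ B) v + dg G B v = dg G A v := by
  rw [← dg_union G Finset.sdiff_disjoint, Finset.sdiff_union_of_subset h]

lemma dg_compl (A : Finset V) (v : V) : dg G Aᶜ v + dg G A v = dg G Finset.univ v := by
  have := dg_sdiff G (Finset.subset_univ A) v
  rwa [← Finset.compl_eq_univ_sdiff] at this

lemma dg_le_card (A : Finset V) (v : V) : dg G A v ≤ A.card := Finset.card_filter_le _ _

lemma dg_singleton (u v : V) : dg G {u} v = if G.Adj v u then 1 else 0 := by
  rw [dg_eq_sum, Finset.sum_singleton]

lemma dg_pos {A : Finset V} {v : V} : 0 < dg G A v ↔ ∃ u ∈ A, G.Adj v u := by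
  simp [dg, Finset.card_pos, Finset.Nonempty]

lemma cr_comm (A B : Finset V) : cr G A B = cr G B A := by
  simp only [cr, dg_eq_sum]
  rw [Finset.sum_comm]
  simp [G.adj_comm]

lemma cr_union_left {A B : Finset V} (C : Finset V) (h : Disjoint A B) :
    cr G (A ∪ B) C = cr G A C + cr G B C := by
  simp [cr, Finset.sum_union h]

lemma cr_union_right {A B : Finset V} (C : Finset V) (h : Disjoint A B) :
    cr G C (A ∪ B) = cr G C A + cr G C B := by
  rw [cr_comm, cr_union_left G C h, cr_comm, cr_comm G B]

lemma cr_singleton (v : V) (B : Finset V) : cr G {v} B = dg G B v := by simp [cr]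

lemma cr_self_sdiff {A D : Finset V} (h : D ⊆ A) :
    cr G A A = cr G (A \ D) (A \ D) + cr G D D + 2 * cr G D (A \ D) := by
  have hd : Disjoint (A \ D) D := Finset.sdiff_disjoint
  conv_lhs => rw [← Finset.sdiff_union_of_subset h]
  rw [cr_union_left G _ hd, cr_union_right G _ hd, cr_union_right G _ hd, cr_comm G (A \ D) D]
  ring

lemma ph_sdiff (k : ℕ) {A D : Finset V} (h : D ⊆ A) :
    ph G k (A \ D) = ph G k A - 2 * ((k : ℤ) - 1) * D.card + cr G D D + 2 * cr G D (A \ D) := by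
  have h1 := cr_self_sdiff G h
  have h2 := Finset.card_sdiff_add_card_eq_card h
  unfold ph
  rw [h1, ← h2]
  push_cast
  ring

lemma dg_erase_self (A : Finset V) (v : V) : dg G (A \ {v}) v = dg G A v := by
  unfold dg
  congr 1
  ext u
  simp only [Finset.mem_filter, Finset.mem_sdiff, Finset.mem_singleton]
  constructor
  · rintro ⟨⟨a, b⟩, c⟩
    exact ⟨a, c⟩
  · rintro ⟨a, c⟩
    exact ⟨⟨a, fun h => G.loopless.irrefl v (h ▸ c)⟩, c⟩

lemma ph_erase (k : ℕ) {A : Finset V} {v : V} (h : v ∈ A) :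
    ph G k (A \ {v}) = ph G k A - 2 * ((k : ℤ) - 1) + 2 * dg G A v := by
  rw [ph_sdiff G k (Finset.singleton_subset_iff.2 h), cr_singleton, cr_singleton, dg_erase_self]
  simp [dg_singleton]

lemma cr_even (A : Finset V) : Even (cr G A A) := by
  induction A using Finset.induction_on with
  | empty => simp [cr]
  | insert v A hv ih =>
    have := cr_self_sdiff G (A := insert v A) (D := {v}) (by simp)
    rw [this, cr_singleton, dg_singleton]
    have h2 : insert v A \ {v} = A := by
      ext u
      simp only [Finset.mem_sdiff, Finset.mem_insert, Finset.mem_singleton]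
      constructor
      · rintro ⟨h | h, h'⟩
        · exact absurd h h'
        · exact h
      · intro h
        exact ⟨Or.inr h, fun h' => hv (h' ▸ h)⟩
    rw [h2]
    simp [ih, Nat.even_add]

lemma ph_even (k : ℕ) (A : Finset V) : Even (ph G k A) := by
  obtain ⟨m, hm⟩ := cr_even G A
  refine ⟨((k : ℤ) - 1) * A.card - m, ?_⟩
  unfold ph
  rw [hm]
  push_cast
  ring

lemma cr_eq_univ (A : Finset V) :
    cr G A A = ∑ u, ∑ v, if (G.Adj u v ∧ u ∈ A ∧ v ∈ A) then 1 else 0 := by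
  simp only [cr, dg_eq_sum]
  rw [← Finset.sum_filter_add_sum_filter_not Finset.univ (fun u => u ∈ A)]
  rw [Finset.sum_eq_zero (s := Finset.univ.filter (fun u => u ∉ A))]
  · simp only [Finset.filter_mem_eq_inter, Finset.univ_inter, add_zero]
    refine Finset.sum_congr rfl fun u hu => ?_
    rw [← Finset.sum_filter_add_sum_filter_not Finset.univ (fun u => u ∈ A)]
    rw [Finset.sum_eq_zero (s := Finset.univ.filter (fun u => u ∉ A))]
    · simp only [Finset.filter_mem_eq_inter, Finset.univ_inter, add_zero]
      refine Finset.sum_congr rfl fun v hv => ?_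
      simp [hu, hv]
    · intro v hv
      simp at hv
      simp [hv]
  · intro u hu
    simp at hu
    simp [hu]

lemma cr_super (A B : Finset V) :
    cr G A A + cr G B B ≤ cr G (A ∩ B) (A ∩ B) + cr G (A ∪ B) (A ∪ B) := by
  simp only [cr_eq_univ, ← Finset.sum_add_distrib]
  refine Finset.sum_le_sum fun u _ => Finset.sum_le_sum fun v _ => ?_
  by_cases h : G.Adj u v <;> by_cases h1 : u ∈ A <;> by_cases h2 : u ∈ B <;>
    by_cases h3 : v ∈ A <;> by_cases h4 : v ∈ B <;> simp [h, h1, h2, h3, h4]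

lemma ph_sub (k : ℕ) (A B : Finset V) :
    ph G k (A ∩ B) + ph G k (A ∪ B) ≤ ph G k A + ph G k B := by
  have h1 := cr_super G A B
  have h2 := Finset.card_union_add_card_inter A B
  unfold ph
  have h3 : (A.card : ℤ) + B.card = (A ∪ B).card + (A ∩ B).card := by exact_mod_cast h2.symm
  have h4 : (cr G A A : ℤ) + cr G B B ≤ cr G (A ∩ B) (A ∩ B) + cr G (A ∪ B) (A ∪ B) := by
    exact_mod_cast h1
  have h5 : 2 * ((k : ℤ) - 1) * A.card + 2 * ((k : ℤ) - 1) * B.card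
    = 2 * ((k : ℤ) - 1) * (A ∪ B).card + 2 * ((k : ℤ) - 1) * (A ∩ B).card := by
    linear_combination 2 * ((k : ℤ) - 1) * h3
  linarith

lemma cr_le (A : Finset V) : cr G A A + A.card ≤ A.card * A.card := by
  have : ∀ v ∈ A, dg G A v + 1 ≤ A.card := by
    intro v hv
    rw [← dg_erase_self]
    have h1 := dg_le_card G (A \ {v}) v
    have h2 := Finset.card_sdiff_add_card_eq_card (Finset.singleton_subset_iff.2 hv)
    simp at h2
    omega
  calc cr G A A + A.card = ∑ v ∈ A, (dg G A v + 1) := by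
        simp [cr, Finset.sum_add_distrib]
    _ ≤ ∑ v ∈ A, A.card := Finset.sum_le_sum this
    _ = _ := by simp

/-- a set of small deficiency contains a non-empty subset of minimum degree at least `k` -/
lemma exists_core (k : ℕ) (hk : 1 ≤ k) (A : Finset V) (hA : k - 1 ≤ A.card)
    (hp : ph G k A < (k : ℤ) * (k - 1)) : ∃ C ⊆ A, C.Nonempty ∧ Cl G k C := by
  induction A using Finset.strongInduction with
  | H A ih =>
    by_cases hc : k - 1 = A.card
    · exfalso
      have h1 := cr_le G A
      have h2 : (A.card : ℤ) = k - 1 := by rw [← hc]; push_cast [hk]; ring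
      have h3 : (cr G A A : ℤ) + A.card ≤ A.card * A.card := by exact_mod_cast h1
      unfold ph at hp
      rw [h2] at hp h3
      nlinarith
    · by_cases hcl : Cl G k A
      · refine ⟨A, subset_rfl, ?_, hcl⟩
        rw [← Finset.card_pos]
        omega
      · unfold Cl at hcl
        push Not at hcl
        obtain ⟨v, hv, hd⟩ := hcl
        have h2 := Finset.card_sdiff_add_card_eq_card (Finset.singleton_subset_iff.2 hv)
        simp at h2
        obtain ⟨C, hC, h3⟩ := ih (A \ {v})
          (Finset.sdiff_ssubset (Finset.singleton_subset_iff.2 hv) (by simp)) (by simp; omega) (by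
            rw [ph_erase G k hv]
            have : (dg G A v : ℤ) + 1 ≤ k := by exact_mod_cast hd
            linarith)
        exact ⟨C, hC.trans Finset.sdiff_subset, h3⟩

/-- the family of units used in the cascade argument -/
structure Units (k : ℕ) (F : Finset (Finset V)) : Prop where
  disj : ∀ D ∈ F, ∀ E ∈ F, ∀ v, v ∈ D → v ∈ E → D = E
  nonadj : ∀ D ∈ F, ∀ E ∈ F, ∀ u v, u ∈ D → v ∈ E → G.Adj u v → D = E
  ne : ∀ D ∈ F, D.Nonempty
  deg : ∀ v, k ≤ dg G Finset.univ v
  degR : ∀ r, (∀ D ∈ F, r ∉ D) → k + 1 ≤ dg G Finset.univ r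
  degD : ∀ D ∈ F, ∀ r, r ∉ D → k ≤ dg G Dᶜ r
  unit : ∀ D ∈ F, (cr G D D : ℤ) + 2 * cr G D Dᶜ = 2 * ((k : ℤ) - 1) * D.card + 2

/-- number of neighbours whose colour differs from `c` -/
def cnt (χ : V → ℕ) (c : ℕ) (r : V) : ℕ := dg G (Finset.univ.filter (fun u => χ u ≠ c)) r

/-- dangerous colours at `r` -/
def bad (k : ℕ) (χ : V → ℕ) (r : V) : Finset ℕ :=
  (Finset.Icc 1 (k + 2)).filter (fun c => cnt G χ c r ≤ k)

structure Inv (k : ℕ) (F : Finset (Finset V)) (A : Finset V) (χ : V → ℕ) : Prop where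
  le : ∀ v, χ v ≤ k + 2
  zero : ∀ v ∈ A, χ v = 0
  const : ∀ D ∈ F, ∀ u ∈ D, ∀ v ∈ D, χ u = χ v
  col : ∀ r, (∀ D ∈ F, r ∉ D) → χ r ≠ 0 → ∀ u, G.Adj r u →
    u ∈ A ∨ χ u = χ r ∨ (χ u = 0 ∧ ∀ D ∈ F, u ∉ D)
  cntk : ∀ r, (∀ D ∈ F, r ∉ D) → r ∉ A → χ r = 0 → ∀ c, 1 ≤ c → c ≤ k + 2 → k ≤ cnt G χ c r
  badk : ∀ r, (∀ D ∈ F, r ∉ D) → r ∉ A → χ r = 0 → (bad G k χ r).card + dg G A r ≤ k + 1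

def Sat (M : Finset (V × V)) (χ : V → ℕ) : Prop :=
  ∀ p ∈ M, ¬ (χ p.1 = χ p.2 ∧ χ p.1 ≠ 0)

def wt (F : Finset (Finset V)) (p : V × V) : ℕ :=
  if ∃ D ∈ F, p.1 ∈ D ∧ p.2 ∈ D then 2 else 1

def pot (F : Finset (Finset V)) (M : Finset (V × V)) : ℕ := ∑ p ∈ M, wt F p

lemma wt_pos (F : Finset (Finset V)) (p : V × V) : 1 ≤ wt F p := by
  unfold wt; split_ifs <;> simp

lemma wt_le (F : Finset (Finset V)) (p : V × V) : wt F p ≤ 2 := by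
  unfold wt; split_ifs <;> simp

lemma pot_union (F : Finset (Finset V)) (M N : Finset (V × V)) :
    pot F (M ∪ N) ≤ pot F M + pot F N := by
  unfold pot
  rw [← Finset.sum_union_inter]
  omega

lemma pot_split (F : Finset (Finset V)) (M : Finset (V × V)) (P : V × V → Prop) [DecidablePred P] :
    pot F M = pot F (M.filter P) + pot F (M.filter (fun p => ¬ P p)) := by
  unfold pot
  rw [Finset.sum_filter_add_sum_filter_not]

lemma card_le_pot (F : Finset (Finset V)) (M : Finset (V × V)) : M.card ≤ pot F M := by
  unfold pot
  rw [Finset.card_eq_sum_ones]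
  exact Finset.sum_le_sum fun p _ => wt_pos F p

lemma pot_le (F : Finset (Finset V)) (M : Finset (V × V)) : pot F M ≤ 2 * M.card := by
  unfold pot
  calc _ ≤ ∑ p ∈ M, 2 := Finset.sum_le_sum fun p _ => wt_le F p
    _ = _ := by simp [mul_comm]

lemma pot_R (F : Finset (Finset V)) (M : Finset (V × V))
    (h : ∀ p ∈ M, ¬ ∃ D ∈ F, p.1 ∈ D ∧ p.2 ∈ D) : pot F M = M.card := by
  unfold pot
  rw [Finset.card_eq_sum_ones]
  refine Finset.sum_congr rfl fun p hp => ?_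
  unfold wt
  rw [if_neg (h p hp)]

lemma cnt_congr {χ χ' : V → ℕ} (c : ℕ) (r : V) (h : ∀ u, G.Adj r u → χ u = χ' u) :
    cnt G χ c r = cnt G χ' c r := by
  unfold cnt dg
  congr 1
  ext u
  simp only [Finset.mem_filter, Finset.mem_univ, true_and]
  constructor
  · rintro ⟨a, b⟩
    exact ⟨h u b ▸ a, b⟩
  · rintro ⟨a, b⟩
    exact ⟨(h u b).symm ▸ a, b⟩

lemma bad_congr (k : ℕ) {χ χ' : V → ℕ} (r : V) (h : ∀ u, G.Adj r u → χ u = χ' u) :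
    bad G k χ r = bad G k χ' r := by
  unfold bad
  congr 1
  ext c
  rw [cnt_congr G c r h]

variable {G}

/-- adding an uncoloured vertex -/
lemma Inv.add_zero_vertex {k : ℕ} {F : Finset (Finset V)} {A : Finset V} {χ : V → ℕ}
    (h : Inv G k F A χ) {r : V} (hr : r ∈ A) (hR : ∀ D ∈ F, r ∉ D)
    (h1 : ∀ c, 1 ≤ c → c ≤ k + 2 → k ≤ cnt G χ c r)
    (h2 : (bad G k χ r).card + dg G A r ≤ k + 1) : Inv G k F (A \ {r}) χ where
  le := h.le
  zero := fun v hv => h.zero v (Finset.mem_sdiff.1 hv).1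
  const := h.const
  col := by
    intro r' hr' hc u hu
    by_cases hur : u = r
    · subst hur
      exact Or.inr (Or.inr ⟨h.zero _ hr, hR⟩)
    · rcases h.col r' hr' hc u hu with h3 | h3
      · left; simp [h3, hur]
      · exact Or.inr h3
  cntk := by
    intro r' hr' hA hz c hc hc'
    by_cases hrr : r' = r
    · subst hrr; exact h1 c hc hc'
    · exact h.cntk r' hr' (fun hh => hA (by simp [hh, hrr])) hz c hc hc'
  badk := by
    intro r' hr' hA hz
    have hm := dg_mono G (Finset.sdiff_subset (s := A) (t := {r})) r'
    by_cases hrr : r' = r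
    · subst hrr; omega
    · have := h.badk r' hr' (fun hh => hA (by simp [hh, hrr])) hz
      omega

/-- adding a coloured vertex -/
lemma Inv.add_col_vertex {k : ℕ} {F : Finset (Finset V)} {A : Finset V} {χ : V → ℕ}
    (h : Inv G k F A χ) {r : V} (hr : r ∈ A) (hR : ∀ D ∈ F, r ∉ D) (c0 : ℕ) (hc0 : c0 ≠ 0)
    (hck : c0 ≤ k + 2)
    (h1 : ∀ u, G.Adj r u → u ∉ A → χ u = c0) :
    Inv G k F (A \ {r}) (Function.update χ r c0) where
  le := by
    intro v
    by_cases hv : v = r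
    · subst hv; simpa using hck
    · simpa [hv] using h.le v
  zero := by
    intro v hv
    simp only [Finset.mem_sdiff, Finset.mem_singleton] at hv
    simp [hv.2, h.zero v hv.1]
  const := by
    intro D hD u hu v hv
    have h3 : u ≠ r := fun hh => hR D hD (hh ▸ hu)
    have h4 : v ≠ r := fun hh => hR D hD (hh ▸ hv)
    simp [h3, h4, h.const D hD u hu v hv]
  col := by
    intro r' hr' hc u hu
    by_cases hrr : r' = r
    · subst hrr
      have hne : u ≠ r' := hu.ne'
      by_cases huA : u ∈ A
      · left; simp [huA, hne]
      · right; left; simp [hne, h1 u hu huA]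
    · simp only [ne_eq, hrr, not_false_eq_true, Function.update_of_ne] at hc
      by_cases hur : u = r
      · subst hur
        right; left
        have : r' ∉ A := fun hh => hc (h.zero _ hh)
        simp [hrr, h1 r' hu.symm this]
      · rcases h.col r' hr' hc u hu with h3 | h3
        · left; simp [h3, hur]
        · right; simpa [hrr, hur] using h3
  cntk := by
    intro r' hr' hA hz c hc hc'
    have hrr : r' ≠ r := by
      rintro rfl
      simp at hz; exact hc0 hz
    have hrA : r' ∉ A := fun hh => hA (by simp [hh, hrr])
    simp only [ne_eq, hrr, not_false_eq_true, Function.update_of_ne] at hz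
    have hna : ¬ G.Adj r' r := fun hh => hc0 (by rw [← h1 r' hh.symm hrA, hz])
    rw [cnt_congr G (χ' := χ)]
    · exact h.cntk r' hr' hrA hz c hc hc'
    · intro u hu
      have : u ≠ r := fun hh => hna (hh ▸ hu)
      simp [this]
  badk := by
    intro r' hr' hA hz
    have hm := dg_mono G (Finset.sdiff_subset (s := A) (t := {r})) r'
    have hrr : r' ≠ r := by
      rintro rfl
      simp at hz; exact hc0 hz
    have hrA : r' ∉ A := fun hh => hA (by simp [hh, hrr])
    simp only [ne_eq, hrr, not_false_eq_true, Function.update_of_ne] at hz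
    have hna : ¬ G.Adj r' r := fun hh => hc0 (by rw [← h1 r' hh.symm hrA, hz])
    rw [bad_congr G k (χ' := χ)]
    · have := h.badk r' hr' hrA hz
      omega
    · intro u hu
      have : u ≠ r := fun hh => hna (hh ▸ hu)
      simp [this]

/-- adding an uncoloured unit -/
lemma Inv.add_zero_unit {k : ℕ} {F : Finset (Finset V)} {A : Finset V} {χ : V → ℕ}
    (h : Inv G k F A χ) {D : Finset V} (hD : D ∈ F) 
    (h1 : ∀ d ∈ D, ∀ r, G.Adj d r → r ∉ A → χ r = 0) :
    Inv G k F (A \ D) χ where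
  le := h.le
  zero := fun v hv => h.zero v (Finset.mem_sdiff.1 hv).1
  const := h.const
  col := by
    intro r' hr' hc u hu
    have hrA : r' ∉ A := fun hh => hc (h.zero _ hh)
    by_cases huD : u ∈ D
    · exact absurd (h1 u huD r' hu.symm hrA) hc
    · rcases h.col r' hr' hc u hu with h3 | h3
      · left; simp [h3, huD]
      · exact Or.inr h3
  cntk := by
    intro r' hr' hA hz c hc hc'
    exact h.cntk r' hr' (fun hh => hA (by simp [hh, hr' D hD])) hz c hc hc'
  badk := by
    intro r' hr' hA hz
    have hm := dg_mono G (Finset.sdiff_subset (s := A) (t := D)) r'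
    have := h.badk r' hr' (fun hh => hA (by simp [hh, hr' D hD])) hz
    omega

/-- adding a coloured unit with exactly one outside edge `d r` -/
lemma Inv.add_col_unit {k : ℕ} {F : Finset (Finset V)} {A : Finset V} {χ : V → ℕ}
    (hF : Units G k F)
    (h : Inv G k F A χ) {D : Finset V} (hD : D ∈ F) (hDA : D ⊆ A) {d r : V} (hd : d ∈ D)
    (hdr : G.Adj d r) (hrA : r ∉ A)
    (h1 : ∀ d' ∈ D, ∀ r', G.Adj d' r' → r' ∉ A → d' = d ∧ r' = r)
    (c0 : ℕ) (hck : c0 ≤ k + 2)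
    (hc1 : χ r ≠ 0 → c0 = χ r) (hc2 : χ r = 0 → c0 ∉ bad G k χ r ∧ c0 ≠ 0) :
    Inv G k F (A \ D) (fun v => if v ∈ D then c0 else χ v) where
  le := by
    intro v
    split_ifs
    · exact hck
    · exact h.le v
  zero := by
    intro v hv
    simp only [Finset.mem_sdiff] at hv
    simp [hv.2, h.zero v hv.1]
  const := by
    intro E hE u hu v hv
    by_cases hED : E = D
    · subst hED; simp [hu, hv]
    · have h3 : u ∉ D := fun hh => hED (hF.disj E hE D hD u hu hh)
      have h4 : v ∉ D := fun hh => hED (hF.disj E hE D hD v hv hh)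
      simp [h3, h4, h.const E hE u hu v hv]
  col := by
    intro r' hr' hc u hu
    have hrD := hr' D hD
    simp only [hrD, if_false] at hc ⊢
    have hrA : r' ∉ A := fun hh => hc (h.zero _ hh)
    by_cases huD : u ∈ D
    · obtain ⟨h3, h4⟩ := h1 u huD r' hu.symm hrA
      subst h4
      right; left
      simp [huD, hc1 hc]
    · simp only [huD, if_false]
      rcases h.col r' hr' hc u hu with h3 | h3
      · left; simp [h3, huD]
      · exact Or.inr h3
  cntk := by
    intro r' hr' hA hz c hc hc'
    have hrD := hr' D hD
    simp only [hrD, if_false] at hz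
    have hrA' : r' ∉ A := fun hh => hA (by simp [hh, hrD])
    have h0 := h.cntk r' hr' hrA' hz c hc hc'
    by_cases hcc : c = c0
    · by_cases hrr : r' = r
      · subst hrr
        have hb := (hc2 hz).1
        rw [← hcc] at hb
        simp only [bad, Finset.mem_filter, Finset.mem_Icc, hc, hc', true_and, not_le] at hb
        have h5 : Finset.univ.filter (fun u => χ u ≠ c ∧ G.Adj r' u) ⊆
            insert d (Finset.univ.filter
              (fun u => (if u ∈ D then c0 else χ u) ≠ c ∧ G.Adj r' u)) := by
          intro u
          simp only [Finset.mem_filter, Finset.mem_univ, true_and, Finset.mem_insert]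
          rintro ⟨a, b⟩
          by_cases huD : u ∈ D
          · left; exact (h1 u huD r' b.symm hrA').1
          · right; simp [huD, a, b]
        have h6 := (Finset.card_le_card h5).trans (Finset.card_insert_le _ _)
        simp only [cnt, dg, Finset.filter_filter] at hb ⊢
        omega
      · rw [cnt_congr G (χ' := χ)]
        · exact h0
        · intro u hu
          have : u ∉ D := fun hh => hrr (h1 u hh r' hu.symm hrA').2
          simp [this]
    · refine h0.trans ?_
      unfold cnt
      refine dg_mono G ?_ r'
      intro u
      simp only [Finset.mem_filter, Finset.mem_univ, true_and]
      intro hu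
      split_ifs
      · exact fun hh => hcc hh.symm
      · exact hu
  badk := by
    intro r' hr' hA hz
    have hm := dg_mono G (Finset.sdiff_subset (s := A) (t := D)) r'
    have hrD := hr' D hD
    simp only [hrD, if_false] at hz
    have hrA' : r' ∉ A := fun hh => hA (by simp [hh, hrD])
    have h0 := h.badk r' hr' hrA' hz
    by_cases hrr : r' = r
    · subst hrr
      have h5 : bad G k (fun v => if v ∈ D then c0 else χ v) r' ⊆ insert c0 (bad G k χ r') := by
        intro c
        simp only [bad, Finset.mem_filter, Finset.mem_insert, Finset.mem_Icc]
        rintro ⟨a, b⟩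
        by_cases hcc : c = c0
        · exact Or.inl hcc
        · right
          refine ⟨a, le_trans ?_ b⟩
          unfold cnt
          refine dg_mono G ?_ r'
          intro u
          simp only [Finset.mem_filter, Finset.mem_univ, true_and]
          intro hu
          split_ifs
          · exact fun hh => hcc hh.symm
          · exact hu
      have h6 := (Finset.card_le_card h5).trans (Finset.card_insert_le _ _)
      have h7 := dg_sdiff G hDA r'
      have h8 : 0 < dg G D r' := (dg_pos G).2 ⟨d, hd, hdr.symm⟩
      omega
    · rw [bad_congr G k (χ' := χ)]
      · omega
      · intro u hu
        have : u ∉ D := fun hh => hrr (h1 u hh r' hu.symm hrA').2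
        simp [this]

variable (G) in
/-- conclusion of the cascade lemma -/
def Casc (k : ℕ) (F : Finset (Finset V)) (A : Finset V) : Prop :=
  ∃ (M : Finset (V × V)) (Λ : Finset (Finset V)),
    (∀ p ∈ M, p.1 ∉ A ∧ p.2 ∉ A) ∧ ((Λ.card : ℤ) + pot F M ≤ 3 * ph G k A) ∧
    ∀ χ, Inv G k F A χ → Sat M χ → ∃ χ' : V → ℕ, (∀ v, v ∉ A → χ' v = χ v) ∧ Inv G k F ∅ χ' ∧
      ∀ D ∈ F, D ⊆ A → D ∉ Λ → ∀ v ∈ D, χ' v ≠ 0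

lemma casc_empty (k : ℕ) (F : Finset (Finset V)) (_hF : Units G k F) : Casc G k F ∅ := by
  refine ⟨∅, ∅, by simp, by simp [pot, ph, cr], ?_⟩
  intro χ h _
  refine ⟨χ, fun _ _ => rfl, h, ?_⟩
  intro D hD hDe _ v hv
  exact absurd (hDe hv) (by simp)

lemma cnt_ge {k : ℕ} {F : Finset (Finset V)} {A : Finset V} {χ : V → ℕ}
    (h : Inv G k F A χ) {c : ℕ} (hc : 1 ≤ c) (r : V) (Z : Finset V) (hZA : ∀ z ∈ Z, z ∉ A)
    (hZ : ∀ z ∈ Z, G.Adj r z ∧ χ z ≠ c) : dg G A r + Z.card ≤ cnt G χ c r := by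
  unfold cnt dg
  rw [← Finset.card_union_of_disjoint]
  · refine Finset.card_le_card ?_
    intro u hu
    simp only [Finset.mem_union, Finset.mem_filter, Finset.mem_univ, true_and] at hu ⊢
    rcases hu with ⟨h1, h2⟩ | h1
    · refine ⟨?_, h2⟩
      rw [h.zero u h1]; omega
    · exact ⟨(hZ u h1).2, (hZ u h1).1⟩
  · rw [Finset.disjoint_left]
    intro u hu huZ
    exact hZA u huZ (Finset.mem_filter.1 hu).1

/-- pairs touching a set -/
def touch (D : Finset V) (p : V × V) : Prop := p.1 ∈ D ∨ p.2 ∈ D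

instance (D : Finset V) : DecidablePred (touch D) := fun p => by unfold touch; infer_instance

lemma sat_of_touch {M1 M : Finset (V × V)} {D : Finset V} {χ χ1 : V → ℕ}
    (hM : M1.filter (fun p => ¬ touch D p) ⊆ M) (hs : Sat M χ) (hχ : ∀ v, v ∉ D → χ1 v = χ v)
    (ht : ∀ p ∈ M1, touch D p → ¬ (χ1 p.1 = χ1 p.2 ∧ χ1 p.1 ≠ 0)) : Sat M1 χ1 := by
  intro p hp
  by_cases h : touch D p
  · exact ht p hp h
  · have h1 := hs p (hM (by simp [hp, h]))
    unfold touch at h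
    push Not at h
    rw [hχ _ h.1, hχ _ h.2]
    exact h1

lemma casc_vertex {k : ℕ} (hk : 1 ≤ k) {F : Finset (Finset V)} (hF : Units G k F) {A : Finset V}
    {r : V} (hr : r ∈ A) (hR : ∀ D ∈ F, r ∉ D) (hlt : dg G A r < k)
    (ih : Casc G k F (A \ {r})) : Casc G k F A := by
  obtain ⟨M1, Λ1, hM1, hp1, ih⟩ := ih
  rw [ph_erase G k hr] at hp1
  set M0 := M1.filter (fun p => ¬ touch {r} p) with hM0
  have hM0A : ∀ p ∈ M0, p.1 ∉ A ∧ p.2 ∉ A := by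
    intro p hp
    simp only [hM0, Finset.mem_filter, touch, Finset.mem_singleton, not_or] at hp
    have := hM1 p hp.1
    simp only [Finset.mem_sdiff, Finset.mem_singleton, hp.2.1, hp.2.2, not_false_eq_true,
      and_true] at this
    exact this
  have hsplit := pot_split F M1 (touch {r})
  rw [← hM0] at hsplit
  have hdeg := hF.degR r hR
  have hcompl := dg_compl G A r
  -- finishing step shared by all cases
  have finish : ∀ (χ χ1 : V → ℕ), (∀ v, v ∉ A → χ1 v = χ v) → Inv G k F (A \ {r}) χ1 → Sat M1 χ1 →
      ∃ χ' : V → ℕ, (∀ v, v ∉ A → χ' v = χ v) ∧ Inv G k F ∅ χ' ∧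
      ∀ D ∈ F, D ⊆ A → D ∉ Λ1 → ∀ v ∈ D, χ' v ≠ 0 := by
    intro χ χ1 h1 h2 h3
    obtain ⟨χ', h4, h5, h6⟩ := ih χ1 h2 h3
    refine ⟨χ', ?_, h5, ?_⟩
    · intro v hv
      rw [h4 v (fun hh => hv (Finset.mem_sdiff.1 hh).1), h1 v hv]
    · intro D hD hDA
      refine h6 D hD ?_
      intro u hu
      simp only [Finset.mem_sdiff, Finset.mem_singleton]
      exact ⟨hDA hu, fun hh => hR D hD (hh ▸ hu)⟩
  by_cases hδ : dg G A r + 1 = k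
  · -- exact case
    have hxy : ∃ x y, x ≠ y ∧ x ∉ A ∧ y ∉ A ∧ G.Adj r x ∧ G.Adj r y ∧
        ¬ ∃ D ∈ F, x ∈ D ∧ y ∈ D := by
      have h2 : 1 < (Aᶜ.filter (fun u => G.Adj r u)).card := by
        have : (Aᶜ.filter (fun u => G.Adj r u)).card = dg G Aᶜ r := rfl
        omega
      obtain ⟨x, hx, y, hy, hne⟩ := Finset.one_lt_card.1 h2
      simp only [Finset.mem_filter, Finset.mem_compl] at hx hy
      by_cases hD : ∃ D ∈ F, x ∈ D
      · obtain ⟨D, hD, hxD⟩ := hD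
        have h3 := hF.degD D hD r (hR D hD)
        have : ∃ z, z ∉ A ∧ z ∉ D ∧ G.Adj r z := by
          by_contra hcon
          push Not at hcon
          have h4 : (Dᶜ.filter (fun u => G.Adj r u)) ⊆ A.filter (fun u => G.Adj r u) := by
            intro u hu
            simp only [Finset.mem_filter, Finset.mem_compl] at hu ⊢
            refine ⟨?_, hu.2⟩
            by_contra h5
            exact hcon u h5 hu.1 hu.2
          have h5 := Finset.card_le_card h4
          unfold dg at h3 hlt
          omega
        obtain ⟨z, hz, hzD, hrz⟩ := this
        refine ⟨x, z, fun hh => hzD (hh ▸ hxD), hx.1, hz, hx.2, hrz, ?_⟩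
        rintro ⟨E, hE, hxE, hzE⟩
        exact hzD (hF.disj D hD E hE x hxD hxE ▸ hzE)
      · refine ⟨x, y, hne, hx.1, hy.1, hx.2, hy.2, ?_⟩
        rintro ⟨E, hE, hxE, _⟩
        exact hD ⟨E, hE, hxE⟩
    obtain ⟨x, y, hne, hxA, hyA, hrx, hry, hxyD⟩ := hxy
    -- behaviour when the neighbours are not monochromatic
    have mixed : ∀ χ, Inv G k F A χ → (¬ ∃ c0, c0 ≠ 0 ∧ ∀ u, G.Adj r u → u ∉ A → χ u = c0) →
        Inv G k F (A \ {r}) χ := by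
      intro χ h hmix
      refine h.add_zero_vertex hr hR ?_ ?_
      · intro c hc hc'
        push Not at hmix
        obtain ⟨u, hu1, hu2, hu3⟩ := hmix c (by omega)
        have := cnt_ge h hc r {u} (by simpa using hu2) (by simpa using ⟨hu1, hu3⟩)
        simp at this
        omega
      · have hsub : bad G k χ r ⊆ {χ x, χ y} := by
          intro c hc
          simp only [bad, Finset.mem_filter, Finset.mem_Icc] at hc
          simp only [Finset.mem_insert, Finset.mem_singleton]
          by_contra hcon
          push Not at hcon
          have := cnt_ge h hc.1.1 r {x, y} (by simp [hxA, hyA])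
            (by simp [hrx, hry, Ne.symm hcon.1, Ne.symm hcon.2])
          rw [Finset.card_pair hne] at this
          omega
        have h1 := (Finset.card_le_card hsub).trans Finset.card_le_two
        omega
    have hcast : ((dg G A r : ℕ) : ℤ) = k - 1 := by rw [← hδ]; push_cast; ring
    by_cases hT : (M1.filter (touch {r})).Nonempty
    · refine ⟨M0 ∪ {(x, y)}, Λ1, ?_, ?_, ?_⟩
      · intro p hp
        rcases Finset.mem_union.1 hp with hp | hp
        · exact hM0A p hp
        · rw [Finset.mem_singleton.1 hp]; exact ⟨hxA, hyA⟩
      · have h1 := pot_union F M0 {(x, y)}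
        have h2 : pot F {(x, y)} = 1 := by rw [pot_R]; · simp
                                           · simpa using hxyD
        have h3 := (Finset.card_pos.2 hT).trans_le (card_le_pot F _)
        have h4 : pot F (M0 ∪ {(x, y)}) ≤ pot F M1 := by omega
        have h5 : ((pot F (M0 ∪ {(x, y)}) : ℕ) : ℤ) ≤ pot F M1 := by exact_mod_cast h4
        linarith
      · intro χ hI hS
        have hmix : ¬ ∃ c0, c0 ≠ 0 ∧ ∀ u, G.Adj r u → u ∉ A → χ u = c0 := by
          rintro ⟨c0, h0, h1⟩
          have := hS (x, y) (by simp)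
          simp only [h1 x hrx hxA, h1 y hry hyA] at this
          exact this ⟨trivial, h0⟩
        refine finish χ χ (fun _ _ => rfl) (mixed χ hI hmix) ?_
        refine sat_of_touch (D := {r}) (M := M0 ∪ {(x, y)}) Finset.subset_union_left hS
          (fun _ _ => rfl) ?_
        rintro p hp (hpt | hpt) ⟨h1, h2⟩
        · rw [Finset.mem_singleton.1 hpt] at h2
          exact h2 (hI.zero r hr)
        · rw [h1, Finset.mem_singleton.1 hpt] at h2
          exact h2 (hI.zero r hr)
    · rw [Finset.not_nonempty_iff_eq_empty] at hT
      refine ⟨M0, Λ1, hM0A, ?_, ?_⟩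
      · have h4 : pot F M0 ≤ pot F M1 := by omega
        have h5 : ((pot F M0 : ℕ) : ℤ) ≤ pot F M1 := by exact_mod_cast h4
        linarith
      · intro χ hI hS
        have hnt : ∀ p ∈ M1, ¬ touch {r} p := by
          intro p hp hpt
          have : p ∈ M1.filter (touch {r}) := by simp [hp, hpt]
          rw [hT] at this
          simp at this
        by_cases hmix : ∃ c0, c0 ≠ 0 ∧ ∀ u, G.Adj r u → u ∉ A → χ u = c0
        · obtain ⟨c0, h0, h1⟩ := hmix
          refine finish χ (Function.update χ r c0) ?_
            (hI.add_col_vertex hr hR c0 h0 ?_ h1) ?_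
          · intro v hv
            have : v ≠ r := fun hh => hv (hh ▸ hr)
            simp [this]
          · rw [← h1 x hrx hxA]; exact hI.le x
          · refine sat_of_touch (D := {r}) (M := M0) subset_rfl hS ?_ ?_
            · intro v hv
              simp only [Finset.mem_singleton] at hv
              simp [hv]
            · intro p hp hpt
              exact absurd hpt (hnt p hp)
        · refine finish χ χ (fun _ _ => rfl) (mixed χ hI hmix) ?_
          refine sat_of_touch (D := {r}) (M := M0) subset_rfl hS (fun _ _ => rfl) ?_
          intro p hp hpt
          exact absurd hpt (hnt p hp)
  · -- gap case
    obtain ⟨δ, hδ'⟩ : ∃ δ, dg G A r + 1 + (δ + 1) = k := ⟨k - 2 - dg G A r, by omega⟩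
    obtain ⟨Z, hZ, hZc⟩ := Finset.exists_subset_card_eq (s := Aᶜ.filter (fun u => G.Adj r u))
      (n := δ + 3) (by
        have : (Aᶜ.filter (fun u => G.Adj r u)).card = dg G Aᶜ r := rfl
        omega)
    have hZ' : ∀ z ∈ Z, z ∉ A ∧ G.Adj r z := by
      intro z hz
      simpa using hZ hz
    refine ⟨M0 ∪ Z.image (fun z => (z, z)), Λ1, ?_, ?_, ?_⟩
    · intro p hp
      rcases Finset.mem_union.1 hp with hp | hp
      · exact hM0A p hp
      · obtain ⟨z, hz, rfl⟩ := Finset.mem_image.1 hp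
        exact ⟨(hZ' z hz).1, (hZ' z hz).1⟩
    · have h1 := pot_union F M0 (Z.image (fun z => (z, z)))
      have h2 := pot_le F (Z.image (fun z => (z, z)))
      have h3 : (Z.image (fun z => (z, z))).card ≤ Z.card := Finset.card_image_le
      have h4 : pot F (M0 ∪ Z.image (fun z => (z, z))) ≤ pot F M1 + 2 * (δ + 3) := by omega
      have h5 : ((pot F (M0 ∪ Z.image (fun z => (z, z))) : ℕ) : ℤ) ≤ pot F M1 + 2 * (δ + 3) := by
        exact_mod_cast h4
      have h6 : ((dg G A r : ℕ) : ℤ) = k - 2 - δ := by rw [← hδ']; push_cast; ring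
      rw [h6] at hp1
      linarith
    · intro χ hI hS
      have hz0 : ∀ z ∈ Z, χ z = 0 := by
        intro z hz
        have := hS (z, z) (by simp [hz])
        by_contra hcon
        exact this ⟨rfl, hcon⟩
      have hcnt : ∀ c, 1 ≤ c → k + 1 ≤ cnt G χ c r := by
        intro c hc
        have := cnt_ge hI hc r Z (fun z hz => (hZ' z hz).1)
          (fun z hz => ⟨(hZ' z hz).2, by rw [hz0 z hz]; omega⟩)
        omega
      refine finish χ χ (fun _ _ => rfl) (hI.add_zero_vertex hr hR ?_ ?_) ?_
      · intro c hc _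
        have := hcnt c hc
        omega
      · have : bad G k χ r = ∅ := by
          unfold bad
          rw [Finset.filter_eq_empty_iff]
          intro c hc
          have := hcnt c (Finset.mem_Icc.1 hc).1
          omega
        rw [this]
        simp
        omega
      · refine sat_of_touch (D := {r}) (M := M0 ∪ Z.image (fun z => (z, z)))
          Finset.subset_union_left hS (fun _ _ => rfl) ?_
        rintro p hp (hpt | hpt) ⟨h1, h2⟩
        · rw [Finset.mem_singleton.1 hpt] at h2
          exact h2 (hI.zero r hr)
        · rw [h1, Finset.mem_singleton.1 hpt] at h2
          exact h2 (hI.zero r hr)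

variable (G) in
lemma cr_eq_card (D B : Finset V) :
    cr G D B = ((D ×ˢ B).filter (fun p => G.Adj p.1 p.2)).card := by
  rw [Finset.card_filter, Finset.sum_product]
  unfold cr
  refine Finset.sum_congr rfl fun a _ => ?_
  rw [dg_eq_sum]

lemma exists_colour {k : ℕ} {F : Finset (Finset V)} {A : Finset V} {χ : V → ℕ}
    (h : Inv G k F A χ) {r : V} (hR : ∀ D ∈ F, r ∉ D) (hrA : r ∉ A) (h0 : χ r = 0)
    (hd : 0 < dg G A r) (e : ℕ) : ∃ c, c ≤ k + 2 ∧ c ∉ bad G k χ r ∧ c ≠ 0 ∧ c ≠ e := by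
  have h1 := h.badk r hR hrA h0
  have h2 : ((bad G k χ r) ∪ {e}).card ≤ k + 1 := by
    have := Finset.card_union_le (bad G k χ r) {e}
    simp at this ⊢
    omega
  have h3 : ¬ (Finset.Icc 1 (k + 2) ⊆ (bad G k χ r) ∪ {e}) := by
    intro hh
    have := Finset.card_le_card hh
    simp at this h2
    omega
  obtain ⟨c, hc, hc'⟩ := Finset.not_subset.1 h3
  simp only [Finset.mem_union, Finset.mem_singleton, not_or] at hc'
  rw [Finset.mem_Icc] at hc
  exact ⟨c, hc.2, hc'.1, by omega, hc'.2⟩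

lemma casc_unit {k : ℕ} {F : Finset (Finset V)} (hF : Units G k F) {A : Finset V}
    {D : Finset V} (hD : D ∈ F) (hDA : D ⊆ A) (hh : 1 ≤ cr G D Aᶜ)
    (ih : Casc G k F (A \ D)) : Casc G k F A := by
  obtain ⟨M1, Λ1, hM1, hp1, ih⟩ := ih
  have hph : ph G k (A \ D) = ph G k A + 2 - 2 * cr G D Aᶜ := by
    have h1 := hF.unit D hD
    have h2 : Dᶜ = (A \ D) ∪ Aᶜ := by
      ext v
      simp only [Finset.mem_compl, Finset.mem_union, Finset.mem_sdiff]
      constructor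
      · intro h
        by_cases hv : v ∈ A
        · exact Or.inl ⟨hv, h⟩
        · exact Or.inr hv
      · rintro (h | h)
        · exact h.2
        · exact fun hh => h (hDA hh)
    rw [h2, cr_union_right] at h1
    · rw [ph_sdiff G k hDA]
      push_cast at h1
      linarith
    · rw [Finset.disjoint_left]
      intro v hv
      simp [(Finset.mem_sdiff.1 hv).1]
  rw [hph] at hp1
  set M0 := M1.filter (fun p => ¬ touch D p) with hM0
  have hsplit := pot_split F M1 (touch D)
  rw [← hM0] at hsplit
  have hM0A : ∀ p ∈ M0, p.1 ∉ A ∧ p.2 ∉ A := by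
    intro p hp
    simp only [hM0, Finset.mem_filter, touch, not_or] at hp
    have := hM1 p hp.1
    simp only [Finset.mem_sdiff, hp.2.1, hp.2.2, not_false_eq_true, and_true] at this
    exact this
  have hNR : ∀ d ∈ D, ∀ r, G.Adj d r → r ∉ A → ∀ E ∈ F, r ∉ E := by
    intro d hd r hdr hrA E hE hrE
    have := hF.nonadj D hD E hE d r hd hrE hdr
    exact hrA (hDA (this ▸ hrE))
  set N := Aᶜ.filter (fun r => ∃ d ∈ D, G.Adj d r) with hN
  have hNc : N.card ≤ cr G D Aᶜ := by
    rw [cr_comm]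
    unfold cr
    rw [Finset.card_eq_sum_ones]
    refine le_trans (Finset.sum_le_sum (g := fun r => dg G D r) ?_)
      (Finset.sum_le_sum_of_subset (Finset.filter_subset _ _))
    intro r hr
    obtain ⟨d, hd, hdr⟩ := (Finset.mem_filter.1 hr).2
    exact (dg_pos G).2 ⟨d, hd, hdr.symm⟩
  -- finishing step
  have finish : ∀ (χ χ1 : V → ℕ), (∀ v, v ∉ A → χ1 v = χ v) → Inv G k F (A \ D) χ1 → Sat M1 χ1 →
      ∃ χ' : V → ℕ, (∀ v, v ∉ A → χ' v = χ v) ∧ Inv G k F ∅ χ' ∧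
      (∀ E ∈ F, E ⊆ A → E ≠ D → E ∉ Λ1 → ∀ v ∈ E, χ' v ≠ 0) ∧ ∀ v ∈ D, χ' v = χ1 v := by
    intro χ χ1 h1 h2 h3
    obtain ⟨χ', h4, h5, h6⟩ := ih χ1 h2 h3
    refine ⟨χ', ?_, h5, ?_, ?_⟩
    · intro v hv
      rw [h4 v (fun hh => hv (Finset.mem_sdiff.1 hh).1), h1 v hv]
    · intro E hE hEA hED
      refine h6 E hE ?_
      intro u hu
      simp only [Finset.mem_sdiff]
      exact ⟨hEA hu, fun hh => hED (hF.disj E hE D hD u hu hh)⟩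
    · intro v hv
      exact h4 v (by simp [hv])
  have lost : 1 + N.card + pot F M0 ≤ pot F M1 + 6 * (cr G D Aᶜ - 1) → Casc G k F A := by
    intro hb
    refine ⟨M0 ∪ N.image (fun z => (z, z)), insert D Λ1, ?_, ?_, ?_⟩
    · intro p hp
      rcases Finset.mem_union.1 hp with hp | hp
      · exact hM0A p hp
      · obtain ⟨z, hz, rfl⟩ := Finset.mem_image.1 hp
        have := Finset.mem_compl.1 (Finset.mem_filter.1 hz).1
        exact ⟨this, this⟩
    · have h1 := pot_union F M0 (N.image (fun z => (z, z)))
      have h2 : pot F (N.image (fun z => (z, z))) = (N.image (fun z => (z, z))).card := by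
        refine pot_R F _ ?_
        rintro p hp ⟨E, hE, h3, _⟩
        obtain ⟨z, hz, rfl⟩ := Finset.mem_image.1 hp
        obtain ⟨hz1, d, hd, hdz⟩ := Finset.mem_filter.1 hz
        exact hNR d hd z hdz (Finset.mem_compl.1 hz1) E hE h3
      have h3 : (N.image (fun z => (z, z))).card ≤ N.card := Finset.card_image_le
      have h4 := Finset.card_insert_le D Λ1
      have h5 : (insert D Λ1).card + pot F (M0 ∪ N.image (fun z => (z, z))) + 6
          ≤ Λ1.card + pot F M1 + 6 * cr G D Aᶜ := by omega
      have h6 : (((insert D Λ1).card : ℕ) : ℤ) + pot F (M0 ∪ N.image (fun z => (z, z))) + 6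
          ≤ Λ1.card + pot F M1 + 6 * cr G D Aᶜ := by exact_mod_cast h5
      linarith
    · intro χ hI hS
      have h0 : ∀ d ∈ D, ∀ r, G.Adj d r → r ∉ A → χ r = 0 := by
        intro d hd r hdr hrA
        have hrN : r ∈ N := by simp only [hN, Finset.mem_filter, Finset.mem_compl]
                               exact ⟨hrA, d, hd, hdr⟩
        have := hS (r, r) (Finset.mem_union_right _ (Finset.mem_image.2 ⟨r, hrN, rfl⟩))
        by_contra hcon
        exact this ⟨rfl, hcon⟩
      obtain ⟨χ', h1, h2, h3, h4⟩ := finish χ χ (fun _ _ => rfl) (hI.add_zero_unit hD h0) (by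
        refine sat_of_touch (D := D) (M := M0 ∪ N.image (fun z => (z, z)))
          Finset.subset_union_left hS (fun _ _ => rfl) ?_
        rintro p hp (hpt | hpt) ⟨h1, h2⟩
        · exact h2 (hI.zero _ (hDA hpt))
        · rw [h1] at h2
          exact h2 (hI.zero _ (hDA hpt)))
      refine ⟨χ', h1, h2, ?_⟩
      intro E hE hEA hEL
      simp only [Finset.mem_insert, not_or] at hEL
      exact h3 E hE hEA hEL.1 hEL.2
  by_cases hone : cr G D Aᶜ = 1
  · have hone' := hone
    rw [cr_eq_card, Finset.card_eq_one] at hone'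
    obtain ⟨⟨d, r⟩, hdr⟩ := hone'
    have hmem : (d, r) ∈ ((D ×ˢ Aᶜ).filter (fun p => G.Adj p.1 p.2)) := by rw [hdr]; simp
    simp only [Finset.mem_filter, Finset.mem_product, Finset.mem_compl] at hmem
    obtain ⟨⟨hd, hrA⟩, hadj⟩ := hmem
    have huniq : ∀ d' ∈ D, ∀ r', G.Adj d' r' → r' ∉ A → d' = d ∧ r' = r := by
      intro d' hd' r' had hr'
      have : (d', r') ∈ ((D ×ˢ Aᶜ).filter (fun p => G.Adj p.1 p.2)) := by
        simp [hd', had, hr']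
      rw [hdr] at this
      simpa using this
    have hrR := hNR d hd r hadj hrA
    have hpos : 0 < dg G A r := (dg_pos G).2 ⟨d, hDA hd, hadj.symm⟩
    -- colouring conclusion
    have colour : ∀ χ, Inv G k F A χ → ∀ c, c ≤ k + 2 → c ≠ 0 → (χ r ≠ 0 → c = χ r) →
        (χ r = 0 → c ∉ bad G k χ r) → Sat M1 (fun v => if v ∈ D then c else χ v) →
        ∃ χ' : V → ℕ, (∀ v, v ∉ A → χ' v = χ v) ∧ Inv G k F ∅ χ' ∧
          ∀ E ∈ F, E ⊆ A → E ∉ Λ1 → ∀ v ∈ E, χ' v ≠ 0 := by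
      intro χ hI c hck hc0 hc1 hc2 hS
      obtain ⟨χ', h1, h2, h3, h4⟩ := finish χ (fun v => if v ∈ D then c else χ v) (by
        intro v hv
        have : v ∉ D := fun hh => hv (hDA hh)
        simp [this]) (hI.add_col_unit hF hD hDA hd hadj hrA huniq c hck hc1
          (fun h => ⟨hc2 h, hc0⟩)) hS
      refine ⟨χ', h1, h2, ?_⟩
      intro E hE hEA hEL v hv
      by_cases hED : E = D
      · subst hED
        rw [h4 v hv]
        simpa [hv] using hc0
      · exact h3 E hE hEA hED hEL v hv
    by_cases hT : (M1.filter (touch D)) = ∅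
    · refine ⟨M0, Λ1, hM0A, ?_, ?_⟩
      · rw [hone] at hp1
        have h5 : ((pot F M0 : ℕ) : ℤ) ≤ pot F M1 := by
          have : pot F M0 ≤ pot F M1 := by omega
          exact_mod_cast this
        push_cast at hp1
        linarith
      · intro χ hI hS
        obtain ⟨c, hck, hc0, hc1, hc2⟩ : ∃ c, c ≤ k + 2 ∧ c ≠ 0 ∧ (χ r ≠ 0 → c = χ r) ∧
            (χ r = 0 → c ∉ bad G k χ r) := by
          by_cases h0 : χ r = 0
          · obtain ⟨c, h1, h2, h3, _⟩ := exists_colour hI hrR hrA h0 hpos 0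
            exact ⟨c, h1, h3, fun h => absurd h0 h, fun _ => h2⟩
          · exact ⟨χ r, hI.le r, h0, fun _ => rfl, fun h => absurd h h0⟩
        refine colour χ hI c hck hc0 hc1 hc2 ?_
        refine sat_of_touch (D := D) (M := M0) subset_rfl hS ?_ ?_
        · intro v hv
          simp [hv]
        · intro p hp hpt
          have : p ∈ M1.filter (touch D) := by simp [hp, hpt]
          rw [hT] at this
          simp at this
    · by_cases hT1 : ∃ p, M1.filter (touch D) = {p} ∧ ¬ (p.1 ∈ D ∧ p.2 ∈ D)
      · obtain ⟨p, hTp, hpD⟩ := hT1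
        have hpm : p ∈ M1.filter (touch D) := by rw [hTp]; simp
        rw [Finset.mem_filter] at hpm
        refine ⟨M0 ∪ {(r, r)}, Λ1, ?_, ?_, ?_⟩
        · intro q hq
          rcases Finset.mem_union.1 hq with hq | hq
          · exact hM0A q hq
          · rw [Finset.mem_singleton.1 hq]; exact ⟨hrA, hrA⟩
        · have h1 := pot_union F M0 {(r, r)}
          have h2 : pot F {(r, r)} = 1 := by
            rw [pot_R]
            · simp
            · simpa using hrR
          have h3 := card_le_pot F (M1.filter (touch D))
          rw [hTp, Finset.card_singleton] at h3
          rw [hTp] at hsplit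
          rw [hone] at hp1
          have h5 : ((pot F (M0 ∪ {(r, r)}) : ℕ) : ℤ) ≤ pot F M1 := by
            have : pot F (M0 ∪ {(r, r)}) ≤ pot F M1 := by omega
            exact_mod_cast this
          push_cast at hp1
          linarith
        · intro χ hI hS
          have h0 : χ r = 0 := by
            have := hS (r, r) (by simp)
            by_contra hcon
            exact this ⟨rfl, hcon⟩
          set e := if p.1 ∈ D then χ p.2 else χ p.1 with he
          obtain ⟨c, h1, h2, h3, h4⟩ := exists_colour hI hrR hrA h0 hpos e
          refine colour χ hI c h1 h3 (fun h => absurd h0 h) (fun _ => h2) ?_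
          refine sat_of_touch (D := D) (M := M0 ∪ {(r, r)}) Finset.subset_union_left hS ?_ ?_
          · intro v hv
            simp [hv]
          · intro q hq hqt
            have : q ∈ M1.filter (touch D) := by simp [hq, hqt]
            rw [hTp, Finset.mem_singleton] at this
            subst this
            rintro ⟨h5, h6⟩
            by_cases hq1 : q.1 ∈ D
            · have hq2 : q.2 ∉ D := fun hh => hpD ⟨hq1, hh⟩
              simp only [hq1, hq2, if_true, if_false] at h5 he
              exact h4 (by rw [he, h5])
            · have hq2 : q.2 ∈ D := hqt.resolve_left hq1
              simp only [hq1, hq2, if_true, if_false] at h5 he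
              exact h4 (by rw [he, h5])
      · refine lost ?_
        have h2 : 2 ≤ pot F (M1.filter (touch D)) := by
          have h3 := card_le_pot F (M1.filter (touch D))
          have h4 := Finset.card_pos.2 (Finset.nonempty_iff_ne_empty.2 hT)
          by_cases h5 : (M1.filter (touch D)).card = 1
          · obtain ⟨p, hp⟩ := Finset.card_eq_one.1 h5
            rw [hp]
            have : p.1 ∈ D ∧ p.2 ∈ D := by
              by_contra hcon
              exact hT1 ⟨p, hp, hcon⟩
            simp only [pot, Finset.sum_singleton, wt]
            rw [if_pos ⟨D, hD, this⟩]
          · omega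
        omega
  · refine lost ?_
    omega

lemma casc {k : ℕ} (hk : 1 ≤ k) {F : Finset (Finset V)} (hF : Units G k F) (A : Finset V)
    (hA : ∀ D ∈ F, D ⊆ A ∨ Disjoint D A) (hcl : ∀ C ⊆ A, C.Nonempty → ¬ Cl G k C) :
    Casc G k F A := by
  induction A using Finset.strongInduction with
  | H A ih =>
    rcases A.eq_empty_or_nonempty with h | h
    · subst h; exact casc_empty k F hF
    · have h1 := hcl A subset_rfl h
      unfold Cl at h1
      push Not at h1
      obtain ⟨v, hv, hd⟩ := h1
      by_cases hR : ∀ D ∈ F, v ∉ D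
      · refine casc_vertex hk hF hv hR hd (ih _ ?_ ?_ ?_)
        · exact Finset.sdiff_ssubset (Finset.singleton_subset_iff.2 hv) (by simp)
        · intro D hD
          rcases hA D hD with h2 | h2
          · left
            intro u hu
            simp only [Finset.mem_sdiff, Finset.mem_singleton]
            exact ⟨h2 hu, fun hh => hR D hD (hh ▸ hu)⟩
          · right
            exact h2.mono_right Finset.sdiff_subset
        · intro C hC
          exact hcl C (hC.trans Finset.sdiff_subset)
      · push Not at hR
        obtain ⟨D, hD, hvD⟩ := hR
        have hDA : D ⊆ A := by
          rcases hA D hD with h2 | h2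
          · exact h2
          · exact absurd hv (Finset.disjoint_left.1 h2 hvD)
        refine casc_unit hF hD hDA ?_ (ih _ ?_ ?_ ?_)
        · have h2 := hF.deg v
          have h3 := dg_compl G A v
          have h4 : dg G Aᶜ v ≤ cr G D Aᶜ :=
            Finset.single_le_sum (f := fun a => dg G Aᶜ a) (fun _ _ => Nat.zero_le _) hvD
          omega
        · exact Finset.sdiff_ssubset hDA ⟨v, hvD⟩
        · intro E hE
          by_cases hED : E = D
          · subst hED
            right
            exact Finset.disjoint_sdiff
          · rcases hA E hE with h2 | h2
            · left
              intro u hu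
              simp only [Finset.mem_sdiff]
              exact ⟨h2 hu, fun hh => hED (hF.disj E hE D hD u hu hh)⟩
            · right
              exact h2.mono_right Finset.sdiff_subset
        · intro C hC
          exact hcl C (hC.trans Finset.sdiff_subset)

lemma closed_of_inv {k : ℕ} {F : Finset (Finset V)} (hF : Units G k F) {χ : V → ℕ}
    (h : Inv G k F ∅ χ) {c : ℕ} (hc : 1 ≤ c) (hck : c ≤ k + 2) :
    Cl G k (Finset.univ.filter (fun u => χ u ≠ c)) := by
  intro v hv
  simp only [Finset.mem_filter, Finset.mem_univ, true_and] at hv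
  have key : (∀ u, G.Adj v u → χ u ≠ c) → k ≤ dg G (Finset.univ.filter (fun u => χ u ≠ c)) v := by
    intro h1
    refine (hF.deg v).trans ?_
    unfold dg
    refine Finset.card_le_card ?_
    intro u hu
    simp only [Finset.mem_filter, Finset.mem_univ, true_and] at hu ⊢
    exact ⟨h1 u hu, hu⟩
  by_cases hR : ∀ D ∈ F, v ∉ D
  · by_cases h0 : χ v = 0
    · exact h.cntk v hR (by simp) h0 c hc hck
    · refine key ?_
      intro u hu
      rcases h.col v hR h0 u hu with h1 | h1 | h1
      · simp at h1
      · rw [h1]; exact hv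
      · rw [h1.1]; omega
  · push Not at hR
    obtain ⟨D, hD, hvD⟩ := hR
    refine key ?_
    intro u hu huc
    by_cases hR' : ∀ E ∈ F, u ∉ E
    · rcases h.col u hR' (by omega) v hu.symm with h1 | h1 | h1
      · simp at h1
      · exact hv (h1.trans huc)
      · exact h1.2 D hD hvD
    · push Not at hR'
      obtain ⟨E, hE, huE⟩ := hR'
      have := hF.nonadj D hD E hE v u hvD huE hu
      subst this
      exact hv ((h.const D hD v hvD u huE).trans huc)

variable (G) in
/-- the critical situation -/
structure Crit (k t L : ℕ) : Prop where
  hk : 3 ≤ k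
  ht : 1 ≤ t
  htk : 2 * t + 4 + k ≤ k * k
  hL1 : 10 ^ 4 * k ^ 2 ≤ L
  hL2 : 100 * k * t ≤ L
  hn : k - 1 ≤ Fintype.card V
  hph : ph G k Finset.univ = 2 * t
  hmin : ∀ Y : Finset V, Y ≠ Finset.univ → k - 1 ≤ Y.card → 2 * (t : ℤ) + 2 ≤ ph G k Y
  hno : ∀ C : Finset V, C.Nonempty → Cl G k C →
    L * Fintype.card V < Fintype.card V + L * C.card

variable {k t L : ℕ}

lemma Crit.htk' (h : Crit G k t L) : 2 * (t : ℤ) + 4 ≤ k * (k - 1) := by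
  have h1 := h.htk
  have : (2 * (t : ℤ) + 4 + k) ≤ k * k := by exact_mod_cast h1
  linarith

lemma Crit.n_ge (h : Crit G k t L) : k + 1 ≤ Fintype.card V := by
  by_contra hcon
  have h1 := h.hn
  have h2 := h.hph
  have h3 := h.htk'
  have h4 := cr_le G (Finset.univ : Finset V)
  rw [Finset.card_univ] at h4
  unfold ph at h2
  rw [Finset.card_univ] at h2
  have h5 : (cr G (Finset.univ : Finset V) Finset.univ : ℤ) + Fintype.card V
    ≤ Fintype.card V * Fintype.card V := by exact_mod_cast h4
  have hk := h.hk
  have h6 : (Fintype.card V : ℤ) = k - 1 ∨ (Fintype.card V : ℤ) = k := by omega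
  rcases h6 with h6 | h6 <;> rw [h6] at h2 h5 <;> nlinarith

lemma card_erase' (v : V) : (Finset.univ \ {v} : Finset V).card + 1 = Fintype.card V := by
  have h2 := Finset.card_sdiff_add_card_eq_card (Finset.subset_univ ({v} : Finset V))
  simpa [Finset.card_univ] using h2

lemma Crit.deg (h : Crit G k t L) (v : V) : k ≤ dg G Finset.univ v := by
  have h1 := h.n_ge
  have h2 := card_erase' v
  have h3 := h.hmin (Finset.univ \ {v}) (by
    intro hh
    have : v ∈ (Finset.univ \ {v} : Finset V) := by rw [hh]; exact Finset.mem_univ v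
    simp at this) (by omega)
  rw [ph_erase G k (Finset.mem_univ v), h.hph] at h3
  have : (k : ℤ) ≤ dg G Finset.univ v := by linarith
  exact_mod_cast this

lemma Crit.hno' (h : Crit G k t L) (D C : Finset V) (hC : C ⊆ Dᶜ) (hne : C.Nonempty)
    (hcl : Cl G k C) : L * D.card < Fintype.card V := by
  have h1 := h.hno C hne hcl
  have h2 := Finset.card_le_card hC
  have h3 := Finset.card_add_card_compl D
  have h4 : L * C.card ≤ L * Dᶜ.card := Nat.mul_le_mul_left _ h2
  have h5 : L * Fintype.card V = L * D.card + L * Dᶜ.card := by rw [← h3]; ring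
  omega

lemma Crit.L_lt (h : Crit G k t L) : L < Fintype.card V := by
  have hn := h.n_ge
  have hk := h.hk
  have : ∃ D C : Finset V, D.card = 1 ∧ C ⊆ Dᶜ ∧ C.Nonempty ∧ Cl G k C := by
    by_cases hd : ∃ v, dg G Finset.univ v = k
    · obtain ⟨v, hv⟩ := hd
      have h2 := card_erase' v
      obtain ⟨C, hC, h3, h4⟩ := exists_core G k (by omega) (Finset.univ \ {v}) (by omega) (by
        rw [ph_erase G k (Finset.mem_univ v), h.hph, hv]
        have := h.htk'
        linarith)
      exact ⟨{v}, C, by simp, by rwa [Finset.compl_eq_univ_sdiff], h3, h4⟩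
    · have : Nonempty V := Fintype.card_pos_iff.1 (by omega)
      obtain ⟨v⟩ := this
      have h2 := card_erase' v
      refine ⟨{v}, Finset.univ \ {v}, by simp, by rw [Finset.compl_eq_univ_sdiff], ?_, ?_⟩
      · rw [← Finset.card_pos]; omega
      · intro u _
        have h3 := dg_sdiff G (Finset.subset_univ {v}) u
        have h4 := dg_le_card G {v} u
        have h5 := h.deg u
        have h6 : dg G Finset.univ u ≠ k := fun hh => hd ⟨u, hh⟩
        simp at h4
        omega
  obtain ⟨D, C, h1, h2, h3, h4⟩ := this
  have := h.hno' D C h2 h3 h4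
  rw [h1] at this
  omega

variable (G) in
def Tight (k t : ℕ) (D : Finset V) : Prop :=
  D.Nonempty ∧ k - 1 ≤ Dᶜ.card ∧ ph G k Dᶜ ≤ 2 * (t : ℤ) + 2

lemma compl_ne_univ {D : Finset V} (h : D.Nonempty) : Dᶜ ≠ Finset.univ := by
  obtain ⟨v, hv⟩ := h
  intro hh
  have : v ∈ Dᶜ := hh ▸ Finset.mem_univ v
  simp [hv] at this

lemma Tight.eq (h : Crit G k t L) {D : Finset V} (hD : Tight G k t D) :
    ph G k Dᶜ = 2 * (t : ℤ) + 2 :=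
  le_antisymm hD.2.2 (h.hmin _ (compl_ne_univ hD.1) hD.2.1)

lemma Tight.small (h : Crit G k t L) {D : Finset V} (hD : Tight G k t D) :
    L * D.card < Fintype.card V := by
  have hk := h.hk
  obtain ⟨C, h1, h2, h3⟩ := exists_core G k (by omega) Dᶜ hD.2.1 (by
    have := h.htk'
    have := hD.2.2
    linarith)
  exact h.hno' D C h1 h2 h3

lemma Crit.L_ge (h : Crit G k t L) : 90000 ≤ L ∧ 10000 * k ≤ L := by
  have h1 := h.hL1
  have h2 := h.hk
  constructor <;> nlinarith

lemma Tight.union_card (h : Crit G k t L) {D E : Finset V} (hD : Tight G k t D)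
    (hE : Tight G k t E) : k - 1 ≤ (D ∪ E)ᶜ.card := by
  have h1 := hD.small h
  have h2 := hE.small h
  obtain ⟨h3, h3'⟩ := h.L_ge
  have h4 : 4 * D.card ≤ L * D.card := Nat.mul_le_mul_right _ (by omega)
  have h5 : 4 * E.card ≤ L * E.card := Nat.mul_le_mul_right _ (by omega)
  have h6 := Finset.card_union_le D E
  have h7 := Finset.card_add_card_compl (D ∪ E)
  have h8 := h.L_lt
  omega

lemma Tight.union (h : Crit G k t L) {D E : Finset V} (hD : Tight G k t D)
    (hE : Tight G k t E) (hDE : (∃ v, v ∈ D ∧ v ∈ E) ∨ ∃ u v, u ∈ D ∧ v ∈ E ∧ G.Adj u v) :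
    Tight G k t (D ∪ E) := by
  refine ⟨hD.1.mono Finset.subset_union_left, hD.union_card h hE, ?_⟩
  by_cases hc : ∃ v, v ∈ D ∧ v ∈ E
  · obtain ⟨v, hv1, hv2⟩ := hc
    have h1 := ph_sub G k Dᶜ Eᶜ
    rw [← Finset.compl_union] at h1
    have h2 := h.hmin (Dᶜ ∪ Eᶜ) (by
      intro hh
      have : v ∈ Dᶜ ∪ Eᶜ := hh ▸ Finset.mem_univ v
      simp [hv1, hv2] at this) (hD.2.1.trans (Finset.card_le_card Finset.subset_union_left))
    have := hD.2.2
    have := hE.2.2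
    linarith
  · have hc' := hDE.resolve_left hc
    push Not at hc
    obtain ⟨u, v, hu, hv, huv⟩ := hc'
    have hEs : E ⊆ Dᶜ := fun x hx => Finset.mem_compl.2 fun hh => hc x hh hx
    have h1 := ph_sdiff G k hEs
    have h2 := ph_sdiff G k (Finset.subset_univ E)
    have h3 : Finset.univ \ E = (Dᶜ \ E) ∪ D := by
      ext x
      simp only [Finset.mem_sdiff, Finset.mem_univ, true_and, Finset.mem_union, Finset.mem_compl]
      constructor
      · intro hx
        by_cases hxD : x ∈ D
        · exact Or.inr hxD
        · exact Or.inl ⟨hxD, hx⟩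
      · rintro (hx | hx)
        · exact hx.2
        · exact hc x hx
    have h4 : cr G E (Finset.univ \ E) = cr G E (Dᶜ \ E) + cr G E D := by
      rw [h3, cr_union_right]
      rw [Finset.disjoint_left]
      intro x hx
      simp only [Finset.mem_sdiff, Finset.mem_compl] at hx
      exact hx.1
    have h5 : 1 ≤ cr G E D := by
      have h6 : 0 < dg G D v := (dg_pos G).2 ⟨u, hu, huv.symm⟩
      exact h6.trans_le
        (Finset.single_le_sum (f := fun a => dg G D a) (fun _ _ => Nat.zero_le _) hv)
    have h5' : (1 : ℤ) ≤ cr G E D := by exact_mod_cast h5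
    rw [h4, ← Finset.compl_eq_univ_sdiff, h.hph] at h2
    have h7 : (D ∪ E)ᶜ = Dᶜ \ E := by
      ext x
      simp
    rw [h7]
    have := hD.2.2
    have := hE.2.2
    push_cast at h2
    linarith

open Classical in
variable (G) in
/-- maximal tight sets -/
noncomputable def fam (k t : ℕ) : Finset (Finset V) :=
  Finset.univ.filter (fun D => Tight G k t D ∧ ∀ E, Tight G k t E → D ⊆ E → E = D)

lemma mem_fam {D : Finset V} : D ∈ fam G k t ↔
    Tight G k t D ∧ ∀ E, Tight G k t E → D ⊆ E → E = D := by
  simp [fam]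

lemma exists_fam {D : Finset V} (hD : Tight G k t D) : ∃ E ∈ fam G k t, D ⊆ E := by
  classical
  obtain ⟨E, hE, hE'⟩ := Finset.exists_max_image
    (Finset.univ.filter (fun E => Tight G k t E ∧ D ⊆ E)) Finset.card ⟨D, by simp [hD]⟩
  simp only [Finset.mem_filter, Finset.mem_univ, true_and] at hE hE'
  refine ⟨E, mem_fam.2 ⟨hE.1, ?_⟩, hE.2⟩
  intro E' h1 h2
  exact (Finset.eq_of_subset_of_card_le h2 (hE' E' ⟨h1, hE.2.trans h2⟩)).symm

lemma Crit.units (h : Crit G k t L) : Units G k (fam G k t) where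
  disj := by
    intro D hD E hE v hv1 hv2
    rw [mem_fam] at hD hE
    have hT := hD.1.union h hE.1 (Or.inl ⟨v, hv1, hv2⟩)
    rw [← hD.2 _ hT Finset.subset_union_left, hE.2 _ hT Finset.subset_union_right]
  nonadj := by
    intro D hD E hE u v hu hv huv
    rw [mem_fam] at hD hE
    have hT := hD.1.union h hE.1 (Or.inr ⟨u, v, hu, hv, huv⟩)
    have h1 := hD.2 _ hT Finset.subset_union_left
    have h2 := hE.2 _ hT Finset.subset_union_right
    exact h1.symm.trans h2
  ne := fun D hD => (mem_fam.1 hD).1.1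
  deg := h.deg
  degR := by
    intro r hr
    have h1 := h.deg r
    by_contra hcon
    have h2 : dg G Finset.univ r = k := by omega
    have h3 := card_erase' r
    have h4 := h.n_ge
    have hT : Tight G k t {r} := by
      refine ⟨by simp, ?_, ?_⟩
      · rw [Finset.compl_eq_univ_sdiff]; omega
      · rw [Finset.compl_eq_univ_sdiff, ph_erase G k (Finset.mem_univ r), h.hph, h2]
        linarith
    obtain ⟨E, hE, hrE⟩ := exists_fam hT
    exact hr E hE (by simpa using hrE)
  degD := by
    intro D hD r hr
    rw [mem_fam] at hD
    by_contra hcon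
    have hk := h.hk
    have hrD : r ∈ Dᶜ := by simpa using hr
    have h7 : (D ∪ {r})ᶜ = Dᶜ \ {r} := by
      ext x
      simp [and_comm]
    have h1 := hD.1.small h
    obtain ⟨h3, h3'⟩ := h.L_ge
    have h4 : 4 * D.card ≤ L * D.card := Nat.mul_le_mul_right _ (by omega)
    have h5 := Finset.card_add_card_compl D
    have h6 := h.L_lt
    have hT : Tight G k t (D ∪ {r}) := by
      refine ⟨by simp, ?_, ?_⟩
      · have h8 := Finset.card_add_card_compl (D ∪ {r})
        have h9 := Finset.card_union_le D {r}
        simp only [Finset.card_singleton] at h9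
        omega
      · rw [h7, ph_erase G k hrD]
        have h8 : (dg G Dᶜ r : ℤ) + 1 ≤ k := by exact_mod_cast Nat.lt_of_not_le hcon
        have := hD.1.2.2
        linarith
    have h10 := hD.2 _ hT Finset.subset_union_left
    exact hr (h10 ▸ (by simp))
  unit := by
    intro D hD
    rw [mem_fam] at hD
    have h1 := hD.1.eq h
    have h2 := ph_sdiff G k (Finset.subset_univ D)
    rw [← Finset.compl_eq_univ_sdiff, h1, h.hph] at h2
    linarith

/-- greedy choice of the seeds -/
lemma exists_seeds (F : Finset (Finset V)) (L n : ℕ) (hn : 0 < n) (hs : ∀ D ∈ F, L * D.card < n)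
    (hb : n ≤ L * ∑ D ∈ F, D.card) :
    ∃ S ⊆ F, ∃ s, n ≤ L * ∑ D ∈ S, D.card ∧ L * ∑ D ∈ S, D.card < 2 * n ∧ L * s < n ∧
      S.card * s ≤ ∑ D ∈ S, D.card ∧ ∀ E ∈ F, E ∉ S → E.card ≤ s := by
  classical
  obtain ⟨S, hS, hmin⟩ := Finset.exists_min_image
    (F.powerset.filter (fun S => n ≤ L * ∑ D ∈ S, D.card ∧
      ∀ D ∈ S, ∀ E ∈ F, E ∉ S → E.card ≤ D.card)) Finset.card
    ⟨F, by simp only [Finset.mem_filter, Finset.mem_powerset, subset_rfl, true_and]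
           exact ⟨hb, fun D _ E h1 h2 => absurd h1 h2⟩⟩
  simp only [Finset.mem_filter, Finset.mem_powerset] at hS hmin
  obtain ⟨hSF, hSn, hTopS⟩ := hS
  have hSne : S.Nonempty := by
    rw [Finset.nonempty_iff_ne_empty]
    rintro rfl
    simp at hSn
    omega
  obtain ⟨D0, hD0, hD0min⟩ := Finset.exists_min_image S Finset.card hSne
  have hsum := Finset.add_sum_erase S (fun D => D.card) hD0
  have hD0s := hs D0 (hSF hD0)
  refine ⟨S, hSF, D0.card, hSn, ?_, hD0s, ?_, ?_⟩
  · have h1 : L * ∑ D ∈ S.erase D0, D.card < n := by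
      by_contra hcon
      have h2 := hmin (S.erase D0) ⟨(Finset.erase_subset _ _).trans hSF, by omega, by
        intro D hD E hE hES
        have hDS := Finset.mem_of_mem_erase hD
        by_cases hED : E = D0
        · subst hED; exact hD0min D hDS
        · exact hTopS D hDS E hE (fun hh => hES (Finset.mem_erase.2 ⟨hED, hh⟩))⟩
      have h3 := Finset.card_erase_lt_of_mem hD0
      omega
    rw [← hsum, Nat.mul_add]
    omega
  · rw [← smul_eq_mul]
    exact Finset.card_nsmul_le_sum S _ _ hD0min
  · intro E hE hES
    exact hTopS D0 hD0 E hE hES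

lemma Crit.ph_biUnion (h : Crit G k t L) (S : Finset (Finset V)) (hS : S ⊆ fam G k t) :
    ph G k (S.biUnion id)ᶜ ≤ 2 * t + 2 * S.card := by
  induction S using Finset.induction_on with
  | empty => simp [h.hph]
  | insert D S hD ih =>
    have h1 := ih (fun x hx => hS (Finset.mem_insert_of_mem hx))
    have hDF := hS (Finset.mem_insert_self D S)
    have h2 := ph_sub G k Dᶜ (S.biUnion id)ᶜ
    have h3 : Dᶜ ∪ (S.biUnion id)ᶜ = Finset.univ := by
      rw [← Finset.compl_inter, Finset.compl_eq_univ_iff]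
      rw [← Finset.disjoint_iff_inter_eq_empty, Finset.disjoint_left]
      intro v hv hv'
      simp only [Finset.mem_biUnion, id] at hv'
      obtain ⟨E, hE, hvE⟩ := hv'
      have := h.units.disj D hDF E (hS (Finset.mem_insert_of_mem hE)) v hv hvE
      exact hD (this ▸ hE)
    have h4 := (mem_fam.1 hDF).1.2.2
    rw [h3, h.hph, ← Finset.compl_union] at h2
    rw [Finset.biUnion_insert, id, Finset.card_insert_of_notMem hD]
    push_cast
    linarith

/-- total size of the maximal tight sets -/
lemma Crit.caseA (h : Crit G k t L) :
    L * ((fam G k t).biUnion id).card ≤ (k + 16 + 6 * t) * Fintype.card V := by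
  have hF := h.units
  have hk := h.hk
  set F := fam G k t with hFdef
  have hdisj : ∀ S ⊆ F, (S.biUnion id).card = ∑ D ∈ S, D.card := by
    intro S hS
    rw [Finset.card_biUnion]
    · rfl
    · intro D hD E hE hne
      simp only [Function.onFun, id]
      rw [Finset.disjoint_left]
      intro v hv hv'
      exact hne (hF.disj D (hS hD) E (hS hE) v hv hv')
  set n := Fintype.card V with hn
  have hnpos : 0 < n := by have := h.n_ge; omega
  by_cases hb : n ≤ L * ∑ D ∈ F, D.card
  · obtain ⟨S, hSF, s, hS1, hS2, hs1, hs2, hs3⟩ := exists_seeds F L n hnpos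
      (fun D hD => (mem_fam.1 hD).1.small h) hb
    rw [← hdisj S hSF] at hS1 hS2 hs2
    set S0 := S.biUnion id with hS0
    have hS0F : ∀ v ∈ S0, ∃ D ∈ S, v ∈ D := by
      intro v hv
      simpa [hS0] using hv
    have hcl : ∀ C ⊆ S0ᶜ, C.Nonempty → ¬ Cl G k C := by
      intro C hC hne hc
      have := h.hno' S0 C hC hne hc
      omega
    have hunit : ∀ D ∈ F, D ⊆ S0ᶜ ∨ Disjoint D S0ᶜ := by
      intro D hD
      by_cases hDS : D ∈ S
      · right
        rw [Finset.disjoint_left]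
        intro v hv
        simp only [Finset.mem_compl, not_not, hS0, Finset.mem_biUnion, id]
        exact ⟨D, hDS, hv⟩
      · left
        intro v hv
        rw [Finset.mem_compl]
        intro hv'
        obtain ⟨E, hE, hvE⟩ := hS0F v hv'
        exact hDS (hF.disj D hD E (hSF hE) v hv hvE ▸ hE)
    obtain ⟨M, Λ, hM, hpot, hc⟩ := casc (by omega) hF S0ᶜ hunit hcl
    have hI : Inv G k F S0ᶜ (fun _ => 0) := by
      have hR : ∀ r, (∀ D ∈ F, r ∉ D) → r ∈ S0ᶜ := by
        intro r hr
        rw [Finset.mem_compl]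
        intro hv
        obtain ⟨D, hD, hrD⟩ := hS0F r hv
        exact hr D (hSF hD) hrD
      exact ⟨by simp, by simp, by simp, by simp, fun r hr hr' => absurd (hR r hr) hr',
        fun r hr hr' => absurd (hR r hr) hr'⟩
    obtain ⟨χ, h1, h2, h3⟩ := hc (fun _ => 0) hI (by intro p _; simp)
    have hΛ : Λ.card ≤ 6 * (t + S.card) := by
      have h4 := h.ph_biUnion S hSF
      rw [← hS0] at h4
      have h5 : (Λ.card : ℤ) ≤ 6 * (t + S.card) := by
        have : (0 : ℤ) ≤ pot F M := by positivity
        linarith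
      exact_mod_cast h5
    have hS0ne : S0.Nonempty := by
      rw [Finset.nonempty_iff_ne_empty]
      intro hh
      rw [hh] at hS1
      simp at hS1
      omega
    have hcol : ∀ c ∈ Finset.Icc 1 (k + 2),
        L * (Finset.univ.filter (fun v => χ v = c)).card ≤ n := by
      intro c hc
      rw [Finset.mem_Icc] at hc
      have h4 := closed_of_inv hF h2 hc.1 hc.2
      refine le_of_lt (h.hno' _ _ ?_ ?_ h4)
      · intro v hv
        simpa using hv
      · obtain ⟨v, hv⟩ := hS0ne
        refine ⟨v, ?_⟩
        simp only [Finset.mem_filter, Finset.mem_univ, true_and]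
        rw [h1 v (by simpa using hv)]
        omega
    set K := (Finset.Icc 1 (k + 2)).biUnion (fun c => Finset.univ.filter (fun v => χ v = c))
      with hK
    have hKc : L * K.card ≤ (k + 2) * n := by
      calc L * K.card ≤ L * ∑ c ∈ Finset.Icc 1 (k + 2),
            (Finset.univ.filter (fun v => χ v = c)).card :=
            Nat.mul_le_mul_left _ Finset.card_biUnion_le
        _ = ∑ c ∈ Finset.Icc 1 (k + 2), L * (Finset.univ.filter (fun v => χ v = c)).card := by
            rw [Finset.mul_sum]
        _ ≤ ∑ c ∈ Finset.Icc 1 (k + 2), n := Finset.sum_le_sum hcol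
        _ = _ := by simp
    set B := (Λ.filter (fun D => D ∈ F ∧ D ∉ S)).biUnion id with hB
    have hBc : B.card ≤ 6 * (t + S.card) * s := by
      calc B.card ≤ (Λ.filter (fun D => D ∈ F ∧ D ∉ S)).card * s := by
            refine Finset.card_biUnion_le_card_mul _ _ _ ?_
            intro D hD
            simp only [Finset.mem_filter] at hD
            exact hs3 D hD.2.1 hD.2.2
        _ ≤ Λ.card * s := Nat.mul_le_mul_right _ (Finset.card_filter_le _ _)
        _ ≤ _ := Nat.mul_le_mul_right _ hΛ
    have hcover : F.biUnion id ⊆ S0 ∪ K ∪ B := by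
      intro v hv
      simp only [Finset.mem_biUnion, id] at hv
      obtain ⟨D, hD, hvD⟩ := hv
      by_cases hDS : D ∈ S
      · refine Finset.mem_union_left _ (Finset.mem_union_left _ ?_)
        simp only [hS0, Finset.mem_biUnion, id]
        exact ⟨D, hDS, hvD⟩
      · by_cases hDL : D ∈ Λ
        · refine Finset.mem_union_right _ ?_
          simp only [hB, Finset.mem_biUnion, id, Finset.mem_filter]
          exact ⟨D, ⟨hDL, hD, hDS⟩, hvD⟩
        · refine Finset.mem_union_left _ (Finset.mem_union_right _ ?_)
          have hDsub : D ⊆ S0ᶜ := by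
            rcases hunit D hD with h4 | h4
            · exact h4
            · exfalso
              have : v ∉ S0ᶜ := Finset.disjoint_left.1 h4 hvD
              simp only [Finset.mem_compl, not_not] at this
              obtain ⟨E, hE, hvE⟩ := hS0F v this
              exact hDS (hF.disj D hD E (hSF hE) v hvD hvE ▸ hE)
          have h4 := h3 D hD hDsub hDL v hvD
          have h5 := h2.le v
          simp only [hK, Finset.mem_biUnion, Finset.mem_Icc, Finset.mem_filter, Finset.mem_univ,
            true_and]
          exact ⟨χ v, ⟨by omega, h5⟩, rfl⟩
    have h4 := Finset.card_le_card hcover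
    have h5 := Finset.card_union_le (S0 ∪ K) B
    have h6 := Finset.card_union_le S0 K
    have h7 : (F.biUnion id).card ≤ S0.card + K.card + 6 * (t + S.card) * s := by omega
    have h8 : L * (S.card * s) ≤ L * S0.card := Nat.mul_le_mul_left _ hs2
    have h9 : t * (L * s) ≤ t * n := Nat.mul_le_mul_left _ hs1.le
    have h10 := Nat.mul_le_mul_left L h7
    have h11 : L * (S0.card + K.card + 6 * (t + S.card) * s)
      = L * S0.card + L * K.card + 6 * (t * (L * s)) + 6 * (L * (S.card * s)) := by ring
    have h12 : (k + 16 + 6 * t) * n = (k + 2) * n + 14 * n + 6 * (t * n) := by ring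
    omega
  · rw [hdisj F subset_rfl]
    have h12 : (k + 16 + 6 * t) * n = n + (k + 15 + 6 * t) * n := by ring
    omega

lemma Crit.false (h : Crit G k t L) : False := by
  classical
  have hA := h.caseA
  have hF := h.units
  have hk := h.hk
  have hnpos : 0 < Fintype.card V := by have := h.n_ge; omega
  set n := Fintype.card V with hn
  set F := fam G k t with hFdef
  set U := F.biUnion id with hU
  have hUmem : ∀ v, v ∈ U ↔ ∃ D ∈ F, v ∈ D := by
    intro v; simp [hU]
  have hdisj : U.card = ∑ D ∈ F, D.card := by
    rw [hU, Finset.card_biUnion]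
    · rfl
    · intro D hD E hE hne
      simp only [Function.onFun, id]
      rw [Finset.disjoint_left]
      intro v hv hv'
      exact hne (hF.disj D hD E hE v hv hv')
  -- numeric bound
  have hW : 10 * ((k + 1) * U.card) ≤ n := by
    have h1 := h.hL1
    have h2 := h.hL2
    have h3 : 10 * (k + 1) * (k + 16 + 6 * t) ≤ L := by nlinarith
    have h4 : L * (10 * ((k + 1) * U.card)) ≤ L * n := by
      calc L * (10 * ((k + 1) * U.card)) = 10 * (k + 1) * (L * U.card) := by ring
        _ ≤ 10 * (k + 1) * ((k + 16 + 6 * t) * n) := Nat.mul_le_mul_left _ hA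
        _ = (10 * (k + 1) * (k + 16 + 6 * t)) * n := by ring
        _ ≤ L * n := Nat.mul_le_mul_right _ h3
    exact Nat.le_of_mul_le_mul_left h4 (by have := h.L_ge; omega)
  -- vertices near U
  set Q := Finset.univ.filter (fun v => v ∉ U ∧ ∃ u ∈ U, G.Adj v u) with hQ
  have hQc : Q.card ≤ k * U.card := by
    have h1 : Q ⊆ F.biUnion (fun D => Dᶜ.filter (fun r => ∃ d ∈ D, G.Adj r d)) := by
      intro v hv
      simp only [hQ, Finset.mem_filter, Finset.mem_univ, true_and] at hv
      obtain ⟨hv, u, hu, huv⟩ := hv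
      obtain ⟨D, hD, huD⟩ := (hUmem u).1 hu
      simp only [Finset.mem_biUnion, Finset.mem_filter, Finset.mem_compl]
      exact ⟨D, hD, fun hh => hv ((hUmem v).2 ⟨D, hD, hh⟩), u, huD, huv⟩
    refine (Finset.card_le_card h1).trans (Finset.card_biUnion_le.trans ?_)
    rw [hdisj, Finset.mul_sum]
    refine Finset.sum_le_sum ?_
    intro D hD
    have h2 : (Dᶜ.filter (fun r => ∃ d ∈ D, G.Adj r d)).card ≤ cr G D Dᶜ := by
      rw [cr_comm]
      unfold cr
      rw [Finset.card_eq_sum_ones]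
      refine le_trans (Finset.sum_le_sum (g := fun r => dg G D r) ?_)
        (Finset.sum_le_sum_of_subset (Finset.filter_subset _ _))
      intro r hr
      exact (dg_pos G).2 (Finset.mem_filter.1 hr).2
    have h3 := hF.unit D hD
    have h4 := Finset.card_pos.2 (hF.ne D hD)
    have h5 : ((cr G D Dᶜ : ℕ) : ℤ) ≤ (k : ℤ) * D.card := by
      have h6 : (1 : ℤ) ≤ D.card := by exact_mod_cast h4
      have h7 : (0 : ℤ) ≤ cr G D D := by positivity
      nlinarith
    have h6 : cr G D Dᶜ ≤ k * D.card := by exact_mod_cast h5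
    omega
  -- high degree vertices
  set H := Finset.univ.filter (fun v => 4 * (k - 1) < dg G Finset.univ v) with hH
  have hHc : 2 * H.card ≤ n := by
    have h1 : H.card * (4 * (k - 1)) ≤ cr G Finset.univ Finset.univ := by
      unfold cr
      rw [← smul_eq_mul]
      refine (Finset.card_nsmul_le_sum H (fun v => dg G Finset.univ v) _ ?_).trans
        (Finset.sum_le_sum_of_subset (Finset.subset_univ _))
      intro v hv
      exact (Finset.mem_filter.1 hv).2.le
    have h2 := h.hph
    unfold ph at h2
    rw [Finset.card_univ] at h2
    obtain ⟨j, rfl⟩ : ∃ j, k = j + 1 := ⟨k - 1, by omega⟩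
    simp only [Nat.add_sub_cancel] at h1
    have h3 : (H.card : ℤ) * (4 * j) ≤ cr G Finset.univ Finset.univ := by exact_mod_cast h1
    have h4 : (2 * j : ℤ) * (2 * H.card) ≤ (2 * j) * n := by
      push_cast at h2
      rw [hn]
      nlinarith
    have h5 : (0 : ℤ) < 2 * j := by
      have : 0 < 2 * j := by omega
      exact_mod_cast this
    have h6 := le_of_mul_le_mul_left h4 h5
    exact_mod_cast h6
  set C := (U ∪ Q ∪ H)ᶜ with hC
  have hCc : 4 * n ≤ 10 * C.card := by
    have h1 := Finset.card_add_card_compl (U ∪ Q ∪ H)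
    rw [← hC] at h1
    have h2 := Finset.card_union_le (U ∪ Q) H
    have h3 := Finset.card_union_le U Q
    have h4 : (k + 1) * U.card = k * U.card + U.card := by ring
    omega
  -- maximal I
  obtain ⟨I, hI, hImax⟩ := Finset.exists_max_image
    (C.powerset.filter (fun I => Iᶜ.Nonempty ∧ Cl G k Iᶜ)) Finset.card ⟨∅, by
      simp only [Finset.mem_filter, Finset.empty_mem_powerset, Finset.compl_empty, true_and]
      exact ⟨Finset.card_pos.1 (by rw [Finset.card_univ]; omega), fun v _ => h.deg v⟩⟩
  simp only [Finset.mem_filter, Finset.mem_powerset] at hI hImax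
  obtain ⟨hIC, hIne, hIcl⟩ := hI
  have hIs := h.hno' I Iᶜ subset_rfl hIne hIcl
  have hcov : C ⊆ I ∪ (I.biUnion (fun i => (Finset.univ.filter (fun v => G.Adj i v)).biUnion
      (fun v => if dg G Iᶜ v = k then Iᶜ.filter (fun w => G.Adj v w) else ∅))) := by
    intro w hw
    by_cases hwI : w ∈ I
    · exact Finset.mem_union_left _ hwI
    · refine Finset.mem_union_right _ ?_
      have h1 : (I ∪ {w})ᶜ = Iᶜ \ {w} := by
        ext x
        simp [and_comm]
      have hwc : w ∈ Iᶜ := by simpa using hwI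
      have h2 : ¬ (Cl G k (Iᶜ \ {w})) := by
        intro hcl
        have h3 := hImax (I ∪ {w}) ⟨Finset.union_subset hIC (by simpa using hw), by
          rw [h1]
          have h4 := hIcl w hwc
          obtain ⟨x, hx, hwx⟩ := (dg_pos G).1 (show 0 < dg G Iᶜ w by omega)
          exact ⟨x, by simp only [Finset.mem_sdiff, Finset.mem_singleton]; exact ⟨hx, hwx.ne'⟩⟩,
          by rw [h1]; exact hcl⟩
        rw [Finset.card_union_of_disjoint (by simpa using hwI)] at h3
        simp at h3
      unfold Cl at h2
      push Not at h2
      obtain ⟨v, hv, hvd⟩ := h2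
      have hvI : v ∈ Iᶜ := (Finset.mem_sdiff.1 hv).1
      have h3 := hIcl v hvI
      have h4 := dg_sdiff G (Finset.singleton_subset_iff.2 hwc) v
      rw [dg_singleton] at h4
      have hadj : G.Adj v w := by
        by_contra hcon
        rw [if_neg hcon] at h4
        omega
      rw [if_pos hadj] at h4
      have h5 : dg G Iᶜ v = k := by omega
      have hvU : v ∉ U := by
        intro hh
        rw [hC, Finset.mem_compl] at hw
        apply hw
        by_cases hwU : w ∈ U
        · simp [hwU]
        · refine Finset.mem_union_left _ (Finset.mem_union_right _ ?_)
          simp only [hQ, Finset.mem_filter, Finset.mem_univ, true_and]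
          exact ⟨hwU, v, hh, hadj.symm⟩
      have h6 := hF.degR v (fun D hD hvD => hvU ((hUmem v).2 ⟨D, hD, hvD⟩))
      have h7 := dg_compl G I v
      obtain ⟨i, hi, hvi⟩ := (dg_pos G).1 (show 0 < dg G I v by omega)
      simp only [Finset.mem_biUnion]
      refine ⟨i, hi, v, by simpa using hvi.symm, ?_⟩
      rw [if_pos h5]
      simp only [Finset.mem_filter]
      exact ⟨hwc, hadj⟩
  have hcard : C.card ≤ I.card + I.card * (4 * (k - 1) * k) := by
    refine (Finset.card_le_card hcov).trans ((Finset.card_union_le _ _).trans ?_)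
    refine Nat.add_le_add_left (Finset.card_biUnion_le_card_mul _ _ _ ?_) _
    intro i hi
    have hiH : dg G Finset.univ i ≤ 4 * (k - 1) := by
      have := hIC hi
      rw [hC, Finset.mem_compl] at this
      by_contra hcon
      refine this (Finset.mem_union_right _ ?_)
      simp only [hH, Finset.mem_filter, Finset.mem_univ, true_and]
      omega
    refine (Finset.card_biUnion_le_card_mul _ _ k ?_).trans (Nat.mul_le_mul_right _ hiH)
    intro v _
    split_ifs with hv
    · exact hv.le
    · simp
  have h1 := h.hL1
  obtain ⟨j, rfl⟩ : ∃ j, k = j + 1 := ⟨k - 1, by omega⟩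
  simp only [Nat.add_sub_cancel] at hcard
  have h2 : 4 * C.card ≤ L * I.card := by
    have h3 : 4 * (1 + 4 * j * (j + 1)) ≤ L := by nlinarith
    calc 4 * C.card ≤ 4 * (I.card + I.card * (4 * j * (j + 1))) := Nat.mul_le_mul_left _ hcard
      _ = (4 * (1 + 4 * j * (j + 1))) * I.card := by ring
      _ ≤ _ := Nat.mul_le_mul_right _ h3
  omega

lemma exists_edge_min {k t : ℕ} (hk : 3 ≤ k) (htk : 2 * t + 4 + k ≤ k * k)
    (hn : k - 1 ≤ Fintype.card V) (m : ℕ) :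
    ∀ (G : SimpleGraph V) [DecidableRel G.Adj], cr G Finset.univ Finset.univ ≤ m →
      ph G k Finset.univ ≤ 2 * t →
      ∃ (H : SimpleGraph V) (_ : DecidableRel H.Adj), H ≤ G ∧ ph H k Finset.univ = 2 * t := by
  induction m with
  | zero =>
    intro G _ hm hp
    exfalso
    have h0 : cr G (Finset.univ : Finset V) Finset.univ = 0 := by omega
    unfold ph at hp
    rw [h0, Finset.card_univ] at hp
    have h1 : (k : ℤ) - 1 ≤ Fintype.card V := by omega
    have h2 : 2 * (t : ℤ) + 4 + k ≤ k * k := by exact_mod_cast htk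
    have h3 : (3 : ℤ) ≤ k := by exact_mod_cast hk
    push_cast at hp
    nlinarith
  | succ m ih =>
    intro G inst hm hp
    by_cases hm' : cr G Finset.univ Finset.univ ≤ m
    · exact ih G hm' hp
    by_cases he : ph G k Finset.univ = 2 * t
    · exact ⟨G, inst, le_rfl, he⟩
    classical
    have hpos : 0 < cr G (Finset.univ : Finset V) Finset.univ := by omega
    rw [cr_eq_card, Finset.card_pos] at hpos
    obtain ⟨⟨u, v⟩, huv⟩ := hpos
    simp only [Finset.mem_filter, Finset.mem_product, Finset.mem_univ, true_and] at huv
    have hsub : ((Finset.univ ×ˢ Finset.univ : Finset (V × V)).filter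
        (fun p => (G.deleteEdges {s(u, v)}).Adj p.1 p.2)) ⊆
        ((Finset.univ ×ˢ Finset.univ : Finset (V × V)).filter (fun p => G.Adj p.1 p.2)).erase
          (u, v) := by
      rintro ⟨a, b⟩ hab
      simp only [Finset.mem_filter, Finset.mem_product, Finset.mem_univ, true_and,
        SimpleGraph.deleteEdges_adj, Set.mem_singleton_iff, Finset.mem_erase] at hab ⊢
      refine ⟨?_, hab.1⟩
      intro hh
      rw [Prod.mk.injEq] at hh
      exact hab.2 (by rw [hh.1, hh.2])
    have hsup : ((Finset.univ ×ˢ Finset.univ : Finset (V × V)).filter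
        (fun p => G.Adj p.1 p.2)) ⊆
        insert (u, v) (insert (v, u) ((Finset.univ ×ˢ Finset.univ : Finset (V × V)).filter
        (fun p => (G.deleteEdges {s(u, v)}).Adj p.1 p.2))) := by
      rintro ⟨a, b⟩ hab
      simp only [Finset.mem_filter, Finset.mem_product, Finset.mem_univ, true_and,
        SimpleGraph.deleteEdges_adj, Set.mem_singleton_iff, Finset.mem_insert,
        Prod.mk.injEq] at hab ⊢
      by_cases h1 : s(a, b) = s(u, v)
      · rw [Sym2.eq_iff] at h1
        tauto
      · exact Or.inr (Or.inr ⟨hab, h1⟩)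
    have h1 := Finset.card_le_card hsub
    have hmem : (u, v) ∈ (Finset.univ ×ˢ Finset.univ : Finset (V × V)).filter
      (fun p => G.Adj p.1 p.2) := by simp [huv]
    rw [Finset.card_erase_of_mem hmem] at h1
    have h2 := (Finset.card_le_card hsup).trans ((Finset.card_insert_le _ _).trans
      (Nat.add_le_add_right (Finset.card_insert_le _ _) 1))
    rw [← cr_eq_card, ← cr_eq_card] at h1 h2
    obtain ⟨H, i, h3, h4⟩ := ih (G.deleteEdges {s(u, v)}) (by omega) (by
      have h5 : ph G k Finset.univ ≤ 2 * t - 2 := by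
        obtain ⟨x, hx⟩ := ph_even G k Finset.univ
        omega
      unfold ph at h5 ⊢
      omega)
    exact ⟨H, i, h3.trans (SimpleGraph.deleteEdges_le _), h4⟩

lemma dg_le_of_le {G H : SimpleGraph V} [DecidableRel G.Adj] [DecidableRel H.Adj] (h : H ≤ G)
    (A : Finset V) (v : V) : dg H A v ≤ dg G A v := by
  unfold dg
  refine Finset.card_le_card ?_
  intro u hu
  rw [Finset.mem_filter] at hu ⊢
  exact ⟨hu.1, h hu.2⟩

lemma dg_map (Y : Finset V) (Z : Finset {x // x ∈ Y}) (v : {x // x ∈ Y}) :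
    dg (G.comap Subtype.val) Z v = dg G (Z.map (Function.Embedding.subtype _)) v.1 := by
  unfold dg
  rw [Finset.filter_map, Finset.card_map]
  rfl

lemma cr_map (Y : Finset V) (Z Z' : Finset {x // x ∈ Y}) :
    cr (G.comap Subtype.val) Z Z' = cr G (Z.map (Function.Embedding.subtype _))
      (Z'.map (Function.Embedding.subtype _)) := by
  unfold cr
  rw [Finset.sum_map]
  exact Finset.sum_congr rfl fun v _ => dg_map Y Z' v

lemma ph_map (k : ℕ) (Y : Finset V) (Z : Finset {x // x ∈ Y}) :
    ph (G.comap Subtype.val) k Z = ph G k (Z.map (Function.Embedding.subtype _)) := by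
  unfold ph
  rw [cr_map, Finset.card_map]

/-- the main theorem in set form -/
lemma main_set {k t L : ℕ} (hk : 3 ≤ k) (ht : 1 ≤ t) (htk : 2 * t + 4 + k ≤ k * k)
    (hL1 : 10 ^ 4 * k ^ 2 ≤ L) (hL2 : 100 * k * t ≤ L) (A : Finset V) (hA : k - 1 ≤ A.card)
    (hp : ph G k A ≤ 2 * t) :
    ∃ C ⊆ A, C.Nonempty ∧ Cl G k C ∧ L * C.card + A.card ≤ L * A.card := by
  classical
  obtain ⟨Y, hY, hYmin⟩ := Finset.exists_min_image
    (A.powerset.filter (fun Y => k - 1 ≤ Y.card ∧ ph G k Y ≤ 2 * t)) Finset.card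
    ⟨A, by
      rw [Finset.mem_filter]
      exact ⟨Finset.mem_powerset_self A, hA, hp⟩⟩
  simp only [Finset.mem_filter, Finset.mem_powerset] at hY hYmin
  obtain ⟨hYA, hYk, hYp⟩ := hY
  have hcardW : Fintype.card {x // x ∈ Y} = Y.card := by simp
  have huniv : (Finset.univ : Finset {x // x ∈ Y}).map (Function.Embedding.subtype _) = Y := by
    ext x
    simp
  obtain ⟨H, i, hHG, hHp⟩ := exists_edge_min hk htk (by rw [hcardW]; exact hYk) _
    (G.comap (Subtype.val : {x // x ∈ Y} → V)) le_rfl (by rw [ph_map, huniv]; exact hYp)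
  by_contra hcon
  push Not at hcon
  refine Crit.false (G := H) (k := k) (t := t) (L := L)
    ⟨hk, ht, htk, hL1, hL2, by rw [hcardW]; exact hYk, hHp, ?_, ?_⟩
  · intro Z hZ hZk
    have h1 : ph (G.comap (Subtype.val : {x // x ∈ Y} → V)) k Z ≤ ph H k Z := by
      unfold ph
      have : cr H Z Z ≤ cr (G.comap (Subtype.val : {x // x ∈ Y} → V)) Z Z :=
        Finset.sum_le_sum fun v _ => dg_le_of_le hHG Z v
      omega
    rw [ph_map] at h1
    have hlt : Z.card < Y.card := by
      rw [← hcardW]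
      exact Finset.card_lt_card (Finset.ssubset_univ_iff.2 hZ)
    have h2 : ¬ ph G k (Z.map (Function.Embedding.subtype _)) ≤ 2 * t := by
      intro h3
      have h4 := hYmin (Z.map (Function.Embedding.subtype _)) ⟨by
        intro x hx
        simp only [Finset.mem_map, Function.Embedding.subtype_apply] at hx
        obtain ⟨y, _, rfl⟩ := hx
        exact hYA y.2, by rw [Finset.card_map]; exact hZk, h3⟩
      rw [Finset.card_map] at h4
      omega
    obtain ⟨x, hx⟩ := ph_even G k (Z.map (Function.Embedding.subtype _))
    omega
  · intro C hne hcl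
    by_contra h1
    rw [hcardW] at h1
    have h2 := hcon (C.map (Function.Embedding.subtype _)) (by
        intro x hx
        simp only [Finset.mem_map, Function.Embedding.subtype_apply] at hx
        obtain ⟨y, _, rfl⟩ := hx
        exact hYA y.2) (by simpa using hne) (by
        intro x hx
        simp only [Finset.mem_map, Function.Embedding.subtype_apply] at hx
        obtain ⟨y, hy, rfl⟩ := hx
        rw [← dg_map]
        exact (hcl y hy).trans (dg_le_of_le hHG C y))
    rw [Finset.card_map] at h2
    have h3 := Finset.card_le_card hYA
    have hLpos : 1 ≤ L := by nlinarith
    obtain ⟨l, rfl⟩ : ∃ l, L = l + 1 := ⟨L - 1, by omega⟩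
    have h4 : l * Y.card ≤ l * A.card := Nat.mul_le_mul_left _ h3
    have h5 : (l + 1) * A.card = l * A.card + A.card := by ring
    have h6 : (l + 1) * Y.card = l * Y.card + Y.card := by ring
    omega

variable (G) in
lemma edges_compl (X : Finset V) :
    (cr G Xᶜ Xᶜ : ℕ) = 2 * (G.edgeFinset.filter (fun e => ¬ ∃ v ∈ X, v ∈ e)).card := by
  classical
  let H : SimpleGraph V :=
    { Adj := fun u v => G.Adj u v ∧ u ∉ X ∧ v ∉ X
      symm := ⟨fun u v h => ⟨h.1.symm, h.2.2, h.2.1⟩⟩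
      loopless := ⟨fun u h => G.loopless.irrefl u h.1⟩ }
  have h1 : H.edgeFinset = G.edgeFinset.filter (fun e => ¬ ∃ v ∈ X, v ∈ e) := by
    ext e
    induction e with
    | h a b =>
      simp only [SimpleGraph.mem_edgeFinset, SimpleGraph.mem_edgeSet, Finset.mem_filter,
        Sym2.mem_iff, H]
      constructor
      · rintro ⟨h2, h3, h4⟩
        refine ⟨h2, ?_⟩
        rintro ⟨v, hv, rfl | rfl⟩
        · exact h3 hv
        · exact h4 hv
      · rintro ⟨h2, h3⟩
        exact ⟨h2, fun h => h3 ⟨a, h, Or.inl rfl⟩, fun h => h3 ⟨b, h, Or.inr rfl⟩⟩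
  rw [← h1, ← SimpleGraph.sum_degrees_eq_twice_card_edges]
  have h2 : ∑ v, H.degree v = cr H Finset.univ Finset.univ := by
    unfold cr
    refine Finset.sum_congr rfl fun v _ => ?_
    rw [← SimpleGraph.card_neighborFinset_eq_degree]
    unfold dg
    congr 1
    ext u
    simp
  rw [h2, cr_eq_card, cr_eq_card]
  congr 1
  ext ⟨a, b⟩
  simp only [Finset.mem_filter, Finset.mem_product, Finset.mem_univ, true_and, Finset.mem_compl, H]
  tauto

end MinDeg

/-- Let `k ≥ 2`, `1 ≤ t ≤ (k-2)(k+1)/2 - 1` and `ε = 1/max(10⁴k², 100kt)`. If `G` has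
`n ≥ k-1` vertices and at least `(k-1)n - t` edges, and `X ⊆ V(G)` satisfies
`1 ≤ |X| ≤ n-k+1` and `ē_G(X) ≤ (k-1)|X|`, then `G - X` contains a non-empty subgraph on at
most `(1-ε)(n-|X|)` vertices with minimum degree at least `k`. -/
theorem remove_cheap_set_small_subgraph {V : Type*} [Fintype V] [DecidableEq V]
    (k t n : ℕ) (hk : 2 ≤ k) (ht1 : 1 ≤ t) (ht2 : t ≤ (k - 2) * (k + 1) / 2 - 1)
    (G : SimpleGraph V) [DecidableRel G.Adj]
    (hn : Fintype.card V = n) (hnk : k - 1 ≤ n)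
    (he : (k - 1) * n ≤ G.edgeFinset.card + t)
    (X : Finset V) (hX1 : X.Nonempty) (hX2 : X.card + k ≤ n + 1)
    (hX3 : eBar G X ≤ (k - 1) * X.card) :
    ∃ s : Finset V, s.Nonempty ∧ Disjoint s X ∧
      (s.card : ℝ) ≤ (1 - 1 / ((max (10 ^ 4 * k ^ 2) (100 * k * t) : ℕ) : ℝ)) *
        ((n : ℝ) - (X.card : ℝ)) ∧
      ∀ v ∈ s, k ≤ (s.filter (fun u => G.Adj v u)).card := by
  have hk3 : 3 ≤ k := by
    by_contra hcon
    have : k = 2 := by omega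
    subst this
    simp at ht2
    omega
  have htk : 2 * t + 4 + k ≤ k * k := by
    obtain ⟨j, rfl⟩ : ∃ j, k = j + 2 := ⟨k - 2, by omega⟩
    simp only [Nat.add_sub_cancel] at ht2
    have h1 : 2 * (j * (j + 2 + 1) / 2) ≤ j * (j + 2 + 1) := Nat.mul_div_le _ _
    have h2 : 2 * t + 2 ≤ j * (j + 2 + 1) := by omega
    nlinarith
  have hcard := Finset.card_add_card_compl X
  rw [hn] at hcard
  have hE := MinDeg.edges_compl G X
  have hsplit := Finset.card_filter_add_card_filter_not (s := G.edgeFinset)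
    (fun e => ∃ v ∈ X, v ∈ e)
  have hb : (G.edgeFinset.filter (fun e => ∃ v ∈ X, v ∈ e)).card ≤ (k - 1) * X.card := hX3
  have hmul : (k - 1) * n = (k - 1) * X.card + (k - 1) * Xᶜ.card := by rw [← hcard]; ring
  have hp : MinDeg.ph G k Xᶜ ≤ 2 * t := by
    have h1 : 2 * ((k - 1) * Xᶜ.card) ≤ MinDeg.cr G Xᶜ Xᶜ + 2 * t := by omega
    have h2 : 2 * (((k - 1 : ℕ) : ℤ) * Xᶜ.card) ≤ MinDeg.cr G Xᶜ Xᶜ + 2 * t := by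
      exact_mod_cast h1
    rw [Nat.cast_sub (by omega)] at h2
    unfold MinDeg.ph
    push_cast at h2 ⊢
    linarith
  obtain ⟨C, hC, hne, hcl, hLC⟩ := MinDeg.main_set hk3 ht1 htk
    (le_max_left (10 ^ 4 * k ^ 2) (100 * k * t)) (le_max_right _ _) Xᶜ (by omega) hp
  refine ⟨C, hne, ?_, ?_, hcl⟩
  · rw [Finset.disjoint_left]
    intro v hv
    exact Finset.mem_compl.1 (hC hv)
  · set L := max (10 ^ 4 * k ^ 2) (100 * k * t) with hL
    have hLpos : 0 < L := lt_of_lt_of_le (by positivity) (le_max_left _ _)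
    have hLr : (0 : ℝ) < (L : ℝ) := by exact_mod_cast hLpos
    have h1 : (n : ℝ) - X.card = (Xᶜ.card : ℝ) := by
      rw [← hcard]
      push_cast
      ring
    have h2 : (L : ℝ) * C.card + Xᶜ.card ≤ L * Xᶜ.card := by exact_mod_cast hLC
    rw [h1]
    have h3 : (1 - 1 / (L : ℝ)) * (Xᶜ.card : ℝ) = (L * Xᶜ.card - Xᶜ.card) / L := by
      field_simp
    rw [h3, le_div_iff₀ hLr]
    linarith
end
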